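/- arXiv:2305.08531 — 15 statements merged into one kernel-verified Lean document; each statement's English description precedes it below -/
import Mathlib

section
/- For any two distinct 2m-element subsets I and J of {1,…,n} there exists a 2m-element subset A of {1,…,n} with |A ∩ I| = m and |A ∩ J| = m. (Hence any two points of the geometry P_m have a common collinear point, so the collinearity graph of P_m is connected of diameter at most 2.) -/
open scoped symmDiff

/-- For any two distinct `2m`-element subsets `I`, `J` of `{1,…,n}` (with `3m ≤ n`, `m > 0`)
there is a `2m`-element subset `A` with `|A ∩ I| = m` and `|A ∩ J| = m`. -/
theorem stmt_0 (n m : ℕ) (hm : 0 < m) (hn : 3 * m ≤ n)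
    (I J : Finset (Fin n)) (hI : I.card = 2 * m) (hJ : J.card = 2 * m) (hIJ : I ≠ J) :
    ∃ A : Finset (Fin n), A.card = 2 * m ∧ (A ∩ I).card = m ∧ (A ∩ J).card = m := by
  have hIs := Finset.card_inter_add_card_sdiff I J
  have hJs := Finset.card_inter_add_card_sdiff J I
  rw [Finset.inter_comm J I] at hJs
  have hU := Finset.card_union_add_card_inter I J
  have hC := Finset.card_add_card_compl (I ∪ J)
  rw [Fintype.card_fin] at hC
  -- `A` takes `a` points of `I ∩ J`, `m - a` of `I \ J`, `m - a` of `J \ I` and `a` outside.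
  obtain ⟨a, ha⟩ : ∃ a, a = (I ∩ J).card - m := ⟨_, rfl⟩
  obtain ⟨X, hX, hXc⟩ := Finset.exists_subset_card_eq (s := I ∩ J) (n := a) (by omega)
  obtain ⟨Y, hY, hYc⟩ := Finset.exists_subset_card_eq (s := I \ J) (n := m - a) (by omega)
  obtain ⟨Z, hZ, hZc⟩ := Finset.exists_subset_card_eq (s := J \ I) (n := m - a) (by omega)
  obtain ⟨W, hW, hWc⟩ := Finset.exists_subset_card_eq (s := (I ∪ J)ᶜ) (n := a) (by omega)
  simp only [Finset.subset_iff, Finset.mem_inter, Finset.mem_sdiff, Finset.mem_compl,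
    Finset.mem_union] at hX hY hZ hW
  have hXY : Disjoint X Y := by rw [Finset.disjoint_left]; grind
  have hXZ : Disjoint X Z := by rw [Finset.disjoint_left]; grind
  have hZW : Disjoint Z W := by rw [Finset.disjoint_left]; grind
  have hXYZW : Disjoint (X ∪ Y) (Z ∪ W) := by rw [Finset.disjoint_left]; grind
  have hAI : ((X ∪ Y) ∪ (Z ∪ W)) ∩ I = X ∪ Y := by ext x; grind
  have hAJ : ((X ∪ Y) ∪ (Z ∪ W)) ∩ J = X ∪ Z := by ext x; grind
  refine ⟨(X ∪ Y) ∪ (Z ∪ W), ?_, ?_, ?_⟩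
  · rw [Finset.card_union_of_disjoint hXYZW, Finset.card_union_of_disjoint hXY,
      Finset.card_union_of_disjoint hZW]
    omega
  · rw [hAI, Finset.card_union_of_disjoint hXY]
    omega
  · rw [hAJ, Finset.card_union_of_disjoint hXZ]
    omega
end

section
/- Suppose n = 3m. If I, J, K are 2m-element subsets of {1,…,n} with |I ∩ J| = m, |I ∩ K| = m and |J ∩ K| = m, then K = I △ J. (Consequently, when n = 3m the maximal cliques of the collinearity graph of P_m are precisely the lines of P_m.) -/
open scoped symmDiff

/-- If `n = 3m` and `I, J, K` are `2m`-element subsets of `{1,…,n}` with pairwise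
intersections of cardinality `m`, then `K = I ∆ J`. -/
theorem stmt_1 (n m : ℕ) (hm : 0 < m) (hn : n = 3 * m)
    (I J K : Finset (Fin n)) (hI : I.card = 2 * m) (hJ : J.card = 2 * m)
    (hK : K.card = 2 * m)
    (hIJ : (I ∩ J).card = m) (hIK : (I ∩ K).card = m) (hJK : (J ∩ K).card = m) :
    K = I ∆ J := by
  have hcover : I ∪ J = Finset.univ := by
    rw [← Finset.card_eq_iff_eq_univ, Fintype.card_fin]
    have := Finset.card_union_add_card_inter I J
    omega
  have hunion : (I ∩ K) ∪ (J ∩ K) = K := by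
    rw [← Finset.union_inter_distrib_right, hcover, Finset.univ_inter]
  have hdisj : (I ∩ K) ∩ (J ∩ K) = ∅ := by
    rw [← Finset.card_eq_zero]
    have := Finset.card_union_add_card_inter (I ∩ K) (J ∩ K)
    rw [hunion] at this
    omega
  have hsub : K ⊆ I ∆ J := by
    intro x hx
    have hxu : x ∈ I ∪ J := hcover ▸ Finset.mem_univ x
    have hxd : x ∉ (I ∩ K) ∩ (J ∩ K) := by simp [hdisj]
    simp only [Finset.mem_union, Finset.mem_inter, Finset.mem_symmDiff] at *
    tauto
  refine Finset.eq_of_subset_of_card_le hsub ?_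
  have hcard : (I ∆ J).card ≤ (I \ J).card + (J \ I).card := Finset.card_union_le _ _
  have h₁ := Finset.card_sdiff_add_card_inter I J
  have h₂ := Finset.card_sdiff_add_card_inter J I
  rw [Finset.inter_comm] at h₂
  omega
end

section
/- Suppose n = 7 and m = 2. Let I and J be 4-element subsets of {1,…,7} with |I ∩ J| = 2, and let K be a 4-element subset of {1,…,7} with K ∉ {I, J, I △ J}. Then the number of elements L of the line {I, J, I △ J} with |K ∩ L| = 2 is exactly 1 or exactly 3. (Thus P_2 satisfies the one-or-all axiom, i.e. it is a polar space.) -/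
open scoped symmDiff

namespace Finset

variable {α : Type*} [DecidableEq α]

theorem card_filter_triple {β : Type*} [DecidableEq β] {x y z : β} (hxy : x ≠ y) (hxz : x ≠ z)
    (hyz : y ≠ z) (p : β → Prop) [DecidablePred p] :
    (({x, y, z} : Finset β).filter p).card =
      (if p x then 1 else 0) + ((if p y then 1 else 0) + (if p z then 1 else 0)) := by
  rw [card_filter, sum_insert (by simp [hxy, hxz]), sum_insert (by simpa using hyz), sum_singleton]

theorem card_inter_eq_sdiff_add (K I J : Finset α) :
    (K ∩ I).card = (K ∩ (I \ J)).card + (K ∩ (I ∩ J)).card := by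
  rw [← card_union_of_disjoint, ← inter_union_distrib_left, sdiff_union_inter]
  exact (disjoint_sdiff_inter I J).mono inter_subset_right inter_subset_right

theorem card_inter_symmDiff (K I J : Finset α) :
    (K ∩ (I ∆ J)).card = (K ∩ (I \ J)).card + (K ∩ (J \ I)).card := by
  rw [← card_union_of_disjoint, ← inter_union_distrib_left]
  · rfl
  · exact disjoint_sdiff_sdiff.mono inter_subset_right inter_subset_right

theorem card_symmDiff_eq_add (I J : Finset α) :
    (I ∆ J).card = (I \ J).card + (J \ I).card :=
  card_union_of_disjoint disjoint_sdiff_sdiff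

theorem card_inter_lt_of_ne {K I : Finset α} (hcard : K.card = I.card) (hne : K ≠ I) :
    (K ∩ I).card < K.card := by
  refine card_lt_card (inter_subset_left.ssubset_of_ne fun h => hne ?_)
  exact eq_of_subset_of_card_le (inter_eq_left.mp h) hcard.ge

theorem card_add_card_union_le [Fintype α] (K I J : Finset α) :
    K.card + (I ∪ J).card ≤ (K ∩ (I ∪ J)).card + Fintype.card α := by
  have h := card_union_add_card_inter K (I ∪ J)
  have := card_le_univ (K ∪ (I ∪ J))
  omega

end Finset

/-- For `n = 7`, `m = 2`: given `4`-element subsets `I, J` of `{1,…,7}` with `|I ∩ J| = 2`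
and a `4`-element subset `K ∉ {I, J, I ∆ J}`, the number of points `L` of the line
`{I, J, I ∆ J}` with `|K ∩ L| = 2` is exactly `1` or exactly `3`. -/
theorem stmt_2 (I J K : Finset (Fin 7)) (hI : I.card = 4) (hJ : J.card = 4)
    (hIJ : (I ∩ J).card = 2) (hK : K.card = 4)
    (hKI : K ≠ I) (hKJ : K ≠ J) (hKIJ : K ≠ I ∆ J) :
    (({I, J, I ∆ J} : Finset (Finset (Fin 7))).filter
        (fun L => (K ∩ L).card = 2)).card = 1 ∨
    (({I, J, I ∆ J} : Finset (Finset (Fin 7))).filter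
        (fun L => (K ∩ L).card = 2)).card = 3 := by
  have hI' := Finset.card_sdiff_add_card_inter I J
  have hJ' := Finset.card_sdiff_add_card_inter J I
  rw [Finset.inter_comm J I] at hJ'
  have hS := Finset.card_symmDiff_eq_add I J
  have hne : I ≠ J := by
    rintro rfl
    simp at hIJ
    omega
  have hIS : I ≠ I ∆ J := by
    intro h
    have hbot : J = ⊥ := symmDiff_eq_left.mp h.symm
    simp [hbot] at hJ
  have hJS : J ≠ I ∆ J := by
    intro h
    have hbot : I = ⊥ := symmDiff_eq_right.mp h.symm
    simp [hbot] at hI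
  have hKI' := Finset.card_inter_lt_of_ne (hK.trans hI.symm) hKI
  have hKJ' := Finset.card_inter_lt_of_ne (hK.trans hJ.symm) hKJ
  have hKS' := Finset.card_inter_lt_of_ne (by omega) hKIJ
  have hI_split := Finset.card_inter_eq_sdiff_add K I J
  have hJ_split := Finset.card_inter_eq_sdiff_add K J I
  rw [Finset.inter_comm J I] at hJ_split
  have hS_split := Finset.card_inter_symmDiff K I J
  have ha := Finset.card_le_card (Finset.inter_subset_right (s₁ := K) (s₂ := I \ J))
  have hb := Finset.card_le_card (Finset.inter_subset_right (s₁ := K) (s₂ := J \ I))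
  have hc := Finset.card_le_card (Finset.inter_subset_right (s₁ := K) (s₂ := I ∩ J))
  have hU := Finset.card_union_add_card_inter I J
  have hKU := Finset.card_add_card_union_le K I J
  have hKU_split : (K ∩ (I ∪ J)).card = (K ∩ I).card + (K ∩ (J \ I)).card := by
    rw [← Finset.union_sdiff_self_eq_union, Finset.inter_union_distrib_left,
      Finset.card_union_of_disjoint]
    exact Finset.disjoint_sdiff.mono Finset.inter_subset_right Finset.inter_subset_right
  rw [Fintype.card_fin] at hKU
  rw [Finset.card_filter_triple hne hIS hJS]
  split_ifs <;> omega
end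

section
/- Suppose n ≥ 3m + 1 and it is not the case that n = 7 and m = 2. Then for any two distinct 2m-element subsets I and J of {1,…,n} with |I ∩ J| = m there exists a 2m-element subset K of {1,…,n} such that |K ∩ I| = m, |K ∩ J| = m, K ≠ I △ J and |K ∩ (I △ J)| ≠ m; that is, K is collinear to both I and J but non-collinear to I △ J. -/
open scoped symmDiff

/-- A set meeting `I ∩ J` and the complement of `I ∪ J` in `a` points each, and `I \ J` and
`J \ I` in `m - a` points each. -/
lemma exists_finset_card_inter_eq {α : Type*} [Fintype α] [DecidableEq α] {m a : ℕ}
    {I J : Finset α} (hI : I.card = 2 * m) (hJ : J.card = 2 * m) (hIJ : (I ∩ J).card = m)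
    (ham : a ≤ m) (hac : 3 * m + a ≤ Fintype.card α) :
    ∃ K : Finset α, K.card = 2 * m ∧ (K ∩ I).card = m ∧ (K ∩ J).card = m ∧
      (K ∩ (I ∆ J)).card = 2 * (m - a) := by
  have hIdiff : (I \ J).card = m := by
    have := Finset.card_sdiff_add_card_inter I J
    omega
  have hJdiff : (J \ I).card = m := by
    have := Finset.card_sdiff_add_card_inter J I
    rw [Finset.inter_comm J I] at this
    omega
  have hcompl : a ≤ (I ∪ J)ᶜ.card := by
    have := Finset.card_union_add_card_inter I J
    rw [Finset.card_compl]
    omega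
  obtain ⟨A, hA, hAc⟩ := Finset.exists_subset_card_eq (ham.trans hIJ.ge)
  obtain ⟨B, hB, hBc⟩ := Finset.exists_subset_card_eq ((Nat.sub_le m a).trans hIdiff.ge)
  obtain ⟨C, hC, hCc⟩ := Finset.exists_subset_card_eq ((Nat.sub_le m a).trans hJdiff.ge)
  obtain ⟨D, hD, hDc⟩ := Finset.exists_subset_card_eq hcompl
  simp only [Finset.subset_iff, Finset.mem_inter, Finset.mem_sdiff, Finset.mem_compl,
    Finset.mem_union] at hA hB hC hD
  have hAB : Disjoint A B := Finset.disjoint_left.2 (by grind)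
  have hAC : Disjoint A C := Finset.disjoint_left.2 (by grind)
  have hBC : Disjoint B C := Finset.disjoint_left.2 (by grind)
  have hABCD : Disjoint (A ∪ (B ∪ C)) D := Finset.disjoint_left.2 (by grind)
  have hABC : Disjoint A (B ∪ C) := Finset.disjoint_union_right.2 ⟨hAB, hAC⟩
  have hKI : (A ∪ (B ∪ C) ∪ D) ∩ I = A ∪ B := by grind
  have hKJ : (A ∪ (B ∪ C) ∪ D) ∩ J = A ∪ C := by grind
  have hKIJ : (A ∪ (B ∪ C) ∪ D) ∩ (I ∆ J) = B ∪ C := by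
    ext x
    simp only [Finset.mem_inter, Finset.mem_symmDiff]
    grind
  refine ⟨A ∪ (B ∪ C) ∪ D, ?_, ?_, ?_, ?_⟩
  · rw [Finset.card_union_of_disjoint hABCD, Finset.card_union_of_disjoint hABC,
      Finset.card_union_of_disjoint hBC]
    omega
  · rw [hKI, Finset.card_union_of_disjoint hAB]
    omega
  · rw [hKJ, Finset.card_union_of_disjoint hAC]
    omega
  · rw [hKIJ, Finset.card_union_of_disjoint hBC]
    omega

/-- If `n ≥ 3m + 1` and not (`n = 7` and `m = 2`), then for any two distinct collinear
points `I, J` of `P_m` there is a point `K` collinear to both `I` and `J` and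
non-collinear to `I ∆ J`. -/
theorem stmt_3 (n m : ℕ) (hm : 0 < m) (hn : 3 * m + 1 ≤ n) (hexc : ¬(n = 7 ∧ m = 2))
    (I J : Finset (Fin n)) (hI : I.card = 2 * m) (hJ : J.card = 2 * m)
    (hIJ : I ≠ J) (hcol : (I ∩ J).card = m) :
    ∃ K : Finset (Fin n), K.card = 2 * m ∧ (K ∩ I).card = m ∧ (K ∩ J).card = m ∧
      K ≠ I ∆ J ∧ (K ∩ (I ∆ J)).card ≠ m := by
  obtain ⟨a, ha, ham, han, h2a⟩ : ∃ a, 0 < a ∧ a ≤ m ∧ 3 * m + a ≤ n ∧ 2 * a ≠ m := by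
    by_cases h : m = 2
    · exact ⟨2, by omega⟩
    · exact ⟨1, by omega⟩
  obtain ⟨K, hK, hKI, hKJ, hKIJ⟩ :=
    exists_finset_card_inter_eq hI hJ hcol ham (by simpa using han)
  refine ⟨K, hK, hKI, hKJ, ?_, by omega⟩
  rintro rfl
  rw [Finset.inter_self] at hKIJ
  omega
end

section
/- Suppose n = 4m − 1. For i ∈ {1,…,n} define a map l_i on 2m-element subsets of {1,…,n} by l_i(I) = I if i ∉ I, and l_i(I) = {1,…,n} \ (I \ {i}) if i ∈ I. Then l_i maps 2m-element subsets bijectively to 2m-element subsets and is an automorphism of the geometry P_m. -/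
open scoped symmDiff

/-- The map `l_i`: it fixes `I` if `i ∉ I` and sends `I` to `{1,…,n} \ (I \ {i})` if `i ∈ I`. -/
def lmap {n : ℕ} (i : Fin n) (I : Finset (Fin n)) : Finset (Fin n) :=
  if i ∈ I then (I.erase i)ᶜ else I

theorem mem_lmap {n : ℕ} {i j : Fin n} {I : Finset (Fin n)} :
    j ∈ lmap i I ↔ if i ∈ I then (j = i ∨ j ∉ I) else j ∈ I := by
  unfold lmap
  split_ifs <;> simp [or_iff_not_imp_left]

theorem lmap_lmap {n : ℕ} (i : Fin n) (I : Finset (Fin n)) : lmap i (lmap i I) = I := by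
  ext j
  grind [mem_lmap]

theorem lmap_symmDiff {n : ℕ} (i : Fin n) (I J : Finset (Fin n)) :
    lmap i (I ∆ J) = lmap i I ∆ lmap i J := by
  ext j
  grind [mem_lmap, Finset.mem_symmDiff]

theorem card_lmap {n m : ℕ} (h : n = 4 * m - 1) (i : Fin n) {I : Finset (Fin n)}
    (hI : I.card = 2 * m) : (lmap i I).card = 2 * m := by
  unfold lmap
  split_ifs with hi
  · have := Finset.card_pos.mpr ⟨i, hi⟩
    rw [Finset.card_compl, Finset.card_erase_of_mem hi, Fintype.card_fin]
    omega
  · exact hI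

theorem card_lmap_iff {n m : ℕ} (h : n = 4 * m - 1) (i : Fin n) {I : Finset (Fin n)} :
    (lmap i I).card = 2 * m ↔ I.card = 2 * m :=
  ⟨fun hI => lmap_lmap i I ▸ card_lmap h i hI, card_lmap h i⟩

/-- Two `2m`-element sets meet in `m` elements iff their symmetric difference has `2m` elements. -/
theorem card_inter_eq_iff_card_symmDiff {α : Type*} [DecidableEq α] {m : ℕ} {I J : Finset α}
    (hI : I.card = 2 * m) (hJ : J.card = 2 * m) :
    (I ∩ J).card = m ↔ (I ∆ J).card = 2 * m := by
  have h₁ := Finset.card_sdiff_add_card_inter I J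
  have h₂ := Finset.card_sdiff_add_card_inter J I
  have h₃ : (I ∆ J).card = (I \ J).card + (J \ I).card :=
    Finset.card_union_of_disjoint disjoint_sdiff_sdiff
  rw [Finset.inter_comm] at h₂
  omega

/-- For `n = 4m - 1`, the map `l_i` maps `2m`-element subsets bijectively to `2m`-element
subsets and is an automorphism of the geometry `P_m`. -/
theorem stmt_4 (n m : ℕ) (hm : 0 < m) (hn : 3 * m ≤ n) (h : n = 4 * m - 1) (i : Fin n) :
    (∀ I : Finset (Fin n), I.card = 2 * m → (lmap i I).card = 2 * m) ∧
    Set.BijOn (lmap i) {I : Finset (Fin n) | I.card = 2 * m}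
      {I : Finset (Fin n) | I.card = 2 * m} ∧
    (∀ I J : Finset (Fin n), I.card = 2 * m → J.card = 2 * m →
      ((I ∩ J).card = m ↔ (lmap i I ∩ lmap i J).card = m)) ∧
    (∀ I J : Finset (Fin n), I.card = 2 * m → J.card = 2 * m → (I ∩ J).card = m →
      lmap i (I ∆ J) = lmap i I ∆ lmap i J) := by
  refine ⟨fun I => card_lmap h i, ?_, fun I J hI hJ => ?_, fun I J _ _ _ => lmap_symmDiff i I J⟩
  · exact Set.InvOn.bijOn ⟨fun I _ => lmap_lmap i I, fun I _ => lmap_lmap i I⟩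
      (fun I => card_lmap h i) (fun I => card_lmap h i)
  · rw [card_inter_eq_iff_card_symmDiff hI hJ,
      card_inter_eq_iff_card_symmDiff (card_lmap h i hI) (card_lmap h i hJ),
      ← lmap_symmDiff, card_lmap_iff h]
end

section
/- Suppose n = 4m. For distinct i, j ∈ {1,…,n} define maps s_ij and s'_ij on 2m-element subsets I of {1,…,n} as follows: if |I ∩ {i,j}| ∈ {0,2} then s_ij(I) = s'_ij(I) = I; if |I ∩ {i,j}| = 1 then s_ij(I) = {1,…,n} \ I and s'_ij(I) = ({1,…,n} \ I) △ {i,j}. Then s_ij and s'_ij both map 2m-element subsets bijectively to 2m-element subsets and are automorphisms of the geometry P_m. -/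
open scoped symmDiff

/-- The map `s_ij`: it fixes `I` if `|I ∩ {i,j}| ∈ {0,2}` and sends `I` to the complement
`{1,…,n} \ I` if `|I ∩ {i,j}| = 1`. -/
def smap {n : ℕ} (i j : Fin n) (I : Finset (Fin n)) : Finset (Fin n) :=
  if (I ∩ {i, j}).card = 1 then Iᶜ else I

/-- The map `s'_ij`: it fixes `I` if `|I ∩ {i,j}| ∈ {0,2}` and sends `I` to
`({1,…,n} \ I) ∆ {i,j}` if `|I ∩ {i,j}| = 1`. -/
def smap' {n : ℕ} (i j : Fin n) (I : Finset (Fin n)) : Finset (Fin n) :=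
  if (I ∩ {i, j}).card = 1 then Iᶜ ∆ {i, j} else I

/-- A bijection of the set of `2m`-element subsets of `{1,…,n}` preserving collinearity
in both directions and compatible with the line structure: an automorphism of `P_m`. -/
def IsAutPm (n m : ℕ) (f : Finset (Fin n) → Finset (Fin n)) : Prop :=
  Set.BijOn f {I : Finset (Fin n) | I.card = 2 * m}
      {I : Finset (Fin n) | I.card = 2 * m} ∧
  (∀ I J : Finset (Fin n), I.card = 2 * m → J.card = 2 * m →
    ((I ∩ J).card = m ↔ (f I ∩ f J).card = m)) ∧
  (∀ I J : Finset (Fin n), I.card = 2 * m → J.card = 2 * m → (I ∩ J).card = m →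
    f (I ∆ J) = f I ∆ f J)

theorem card_symmDiff_add_two_mul_card_inter {α : Type*} [DecidableEq α] (A B : Finset α) :
    (A ∆ B).card + 2 * (A ∩ B).card = A.card + B.card := by
  have hd : Disjoint (A \ B) (B \ A) := disjoint_sdiff_sdiff
  have hc : (A ∆ B).card = (A \ B).card + (B \ A).card := Finset.card_union_of_disjoint hd
  have h₁ := Finset.card_sdiff_add_card_inter A B
  have h₂ := Finset.card_sdiff_add_card_inter B A
  rw [Finset.inter_comm B A] at h₂
  omega

theorem card_inter_pair_eq_one_iff {α : Type*} [DecidableEq α] {i j : α} (hij : i ≠ j)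
    (I : Finset α) : (I ∩ {i, j}).card = 1 ↔ ¬(i ∈ I ↔ j ∈ I) := by
  by_cases hi : i ∈ I <;> by_cases hj : j ∈ I <;>
    simp [Finset.inter_insert_of_mem, Finset.inter_insert_of_notMem, hi, hj, hij]

/-- Two `2m`-element sets are collinear exactly when their symmetric difference is again
a `2m`-element set, so an additive involution preserving the `2m`-element sets is an
automorphism. -/
theorem isAutPm_of_involutive {n m : ℕ} {f : Finset (Fin n) → Finset (Fin n)}
    (hcard : ∀ I : Finset (Fin n), I.card = 2 * m → (f I).card = 2 * m)
    (hinv : Function.Involutive f) (hadd : ∀ I J, f (I ∆ J) = f I ∆ f J) :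
    IsAutPm n m f := by
  refine ⟨⟨hcard, hinv.injective.injOn, fun I hI => ⟨f I, hcard I hI, hinv I⟩⟩, ?_,
    fun I J _ _ _ => hadd I J⟩
  intro I J hI hJ
  have h₁ := card_symmDiff_add_two_mul_card_inter I J
  have h₂ := card_symmDiff_add_two_mul_card_inter (f I) (f J)
  have hfI := hcard I hI
  have hfJ := hcard J hJ
  have h₃ : (I ∆ J).card = 2 * m ↔ (f I ∆ f J).card = 2 * m := by
    rw [← hadd]
    exact ⟨hcard _, fun h => by simpa only [hinv (I ∆ J)] using hcard _ h⟩
  omega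

theorem mem_smap {n : ℕ} {i j : Fin n} (hij : i ≠ j) (I : Finset (Fin n)) (x : Fin n) :
    x ∈ smap i j I ↔ ((i ∈ I ↔ j ∈ I) ↔ x ∈ I) := by
  unfold smap
  split_ifs with h <;> rw [card_inter_pair_eq_one_iff hij] at h
  · simp only [Finset.mem_compl]
    tauto
  · tauto

theorem mem_smap' {n : ℕ} {i j : Fin n} (hij : i ≠ j) (I : Finset (Fin n)) (x : Fin n) :
    x ∈ smap' i j I ↔ (((i ∈ I ↔ j ∈ I) ∨ x = i ∨ x = j) ↔ x ∈ I) := by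
  unfold smap'
  split_ifs with h <;> rw [card_inter_pair_eq_one_iff hij] at h
  · simp only [Finset.mem_symmDiff, Finset.mem_compl, Finset.mem_insert, Finset.mem_singleton]
    tauto
  · tauto

theorem smap_symmDiff {n : ℕ} {i j : Fin n} (hij : i ≠ j) (I J : Finset (Fin n)) :
    smap i j (I ∆ J) = smap i j I ∆ smap i j J := by
  ext x
  simp only [mem_smap hij, Finset.mem_symmDiff]
  grind

theorem smap'_symmDiff {n : ℕ} {i j : Fin n} (hij : i ≠ j) (I J : Finset (Fin n)) :
    smap' i j (I ∆ J) = smap' i j I ∆ smap' i j J := by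
  ext x
  simp only [mem_smap' hij, Finset.mem_symmDiff]
  grind

theorem smap_involutive {n : ℕ} {i j : Fin n} (hij : i ≠ j) :
    Function.Involutive (smap i j) := by
  intro I
  ext x
  simp only [mem_smap hij]
  tauto

theorem smap'_involutive {n : ℕ} {i j : Fin n} (hij : i ≠ j) :
    Function.Involutive (smap' i j) := by
  intro I
  ext x
  simp only [mem_smap' hij, true_or, or_true, true_iff]
  tauto

theorem card_smap {m : ℕ} {i j : Fin (4 * m)} {I : Finset (Fin (4 * m))}
    (hI : I.card = 2 * m) : (smap i j I).card = 2 * m := by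
  unfold smap
  split_ifs
  · rw [Finset.card_compl, Fintype.card_fin]
    omega
  · exact hI

theorem card_smap' {m : ℕ} {i j : Fin (4 * m)} (hij : i ≠ j) {I : Finset (Fin (4 * m))}
    (hI : I.card = 2 * m) : (smap' i j I).card = 2 * m := by
  unfold smap'
  split_ifs with h <;> rw [card_inter_pair_eq_one_iff hij] at h
  · have hc : Iᶜ.card = 2 * m := by
      rw [Finset.card_compl, Fintype.card_fin]
      omega
    have h₁ : (Iᶜ ∩ {i, j}).card = 1 := by
      rw [card_inter_pair_eq_one_iff hij]
      simp only [Finset.mem_compl]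
      tauto
    have h₂ := card_symmDiff_add_two_mul_card_inter Iᶜ {i, j}
    rw [Finset.card_pair hij] at h₂
    omega
  · exact hI

/-- For `n = 4m` and distinct `i, j`, the maps `s_ij` and `s'_ij` map `2m`-element subsets
bijectively to `2m`-element subsets and are automorphisms of the geometry `P_m`. -/
theorem stmt_5 (n m : ℕ) (hm : 0 < m) (hn : 3 * m ≤ n) (h : n = 4 * m)
    (i j : Fin n) (hij : i ≠ j) :
    (∀ I : Finset (Fin n), I.card = 2 * m → (smap i j I).card = 2 * m) ∧
    (∀ I : Finset (Fin n), I.card = 2 * m → (smap' i j I).card = 2 * m) ∧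
    IsAutPm n m (smap i j) ∧ IsAutPm n m (smap' i j) := by
  subst h
  exact ⟨fun _ => card_smap, fun _ => card_smap' hij,
    isAutPm_of_involutive (fun _ => card_smap) (smap_involutive hij) (smap_symmDiff hij),
    isAutPm_of_involutive (fun _ => card_smap' hij) (smap'_involutive hij) (smap'_symmDiff hij)⟩
end

section
/- Suppose n = 4m − 1. For i ∈ {1,…,n} let l_i be the map on 2m-element subsets given by l_i(I) = I if i ∉ I and l_i(I) = {1,…,n} \ (I \ {i}) if i ∈ I. Then for every automorphism f of P_m there exists a permutation σ of {1,…,n} such that either f(I) = σ(I) for every 2m-element subset I, or there exists i ∈ {1,…,n} with f(I) = σ(l_i(I)) for every 2m-element subset I. -/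
open scoped symmDiff

open Finset.HasAntidiagonal (antidiagonal)

theorem two_mul_le_sum_of_involution {ι : Type*} [DecidableEq ι] (E : Finset ι) (t : ι → ℕ)
    (r : ι → ι) (hr : ∀ p ∈ E, r p ∈ E) (ht : ∀ p ∈ E, t (r p) = t p)
    (hne : ∀ p ∈ E, r p ≠ p) {p : ι} (hp : p ∈ E) : 2 * t p ≤ ∑ q ∈ E, t q := by
  have h : ∑ q ∈ {p, r p}, t q ≤ ∑ q ∈ E, t q :=
    Finset.sum_le_sum_of_subset (by
      intro q hq
      simp only [Finset.mem_insert, Finset.mem_singleton] at hq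
      rcases hq with rfl | rfl
      exacts [hp, hr _ hp])
  rw [Finset.sum_pair (hne p hp).symm, ht p hp] at h
  omega

theorem two_mul_sum_sq_le_sq_sum {ι : Type*} (E : Finset ι) (t : ι → ℕ)
    (h : ∀ p ∈ E, 2 * t p ≤ ∑ q ∈ E, t q) :
    2 * ∑ p ∈ E, t p ^ 2 ≤ (∑ p ∈ E, t p) ^ 2 := by
  rw [Finset.mul_sum, sq, Finset.sum_mul]
  refine Finset.sum_le_sum fun p hp => ?_
  nlinarith [h p hp, Nat.zero_le (t p)]

theorem two_mul_sum_sq_lt_sq_sum {ι : Type*} (E : Finset ι) (t : ι → ℕ)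
    (h : ∀ p ∈ E, 2 * t p ≤ ∑ q ∈ E, t q) {p : ι} (hp : p ∈ E) (h0 : 0 < t p)
    (hlt : 2 * t p < ∑ q ∈ E, t q) :
    2 * ∑ p ∈ E, t p ^ 2 < (∑ p ∈ E, t p) ^ 2 := by
  rw [Finset.mul_sum, sq, Finset.sum_mul]
  refine Finset.sum_lt_sum (fun p hp => ?_) ⟨p, hp, ?_⟩
  · nlinarith [h p hp, Nat.zero_le (t p)]
  · nlinarith

/-- The indices of the nonzero terms of Vandermonde's sum for `(a + b).choose m`. -/
def vandermondeSupport (a b m : ℕ) : Finset (ℕ × ℕ) :=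
  (antidiagonal m).filter fun p => p.1 ≤ a ∧ p.2 ≤ b

theorem mem_vandermondeSupport {a b m : ℕ} {p : ℕ × ℕ} :
    p ∈ vandermondeSupport a b m ↔ p.1 + p.2 = m ∧ p.1 ≤ a ∧ p.2 ≤ b := by
  simp [vandermondeSupport]

/-- The number of ways of choosing `p.1` out of `a` and `p.2` out of `b` objects. -/
def vandermondeTerm (a b : ℕ) (p : ℕ × ℕ) : ℕ := a.choose p.1 * b.choose p.2

theorem vandermondeTerm_eq_zero {a b m : ℕ} {p : ℕ × ℕ} (hp : p ∈ antidiagonal m)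
    (h : p ∉ vandermondeSupport a b m) : vandermondeTerm a b p = 0 := by
  rw [mem_vandermondeSupport] at h
  rw [Finset.HasAntidiagonal.mem_antidiagonal] at hp
  rcases lt_or_ge a p.1 with h1 | h1
  · simp [vandermondeTerm, Nat.choose_eq_zero_of_lt h1]
  · simp [vandermondeTerm, Nat.choose_eq_zero_of_lt (show b < p.2 by omega)]

theorem vandermondeTerm_pos {a b m : ℕ} {p : ℕ × ℕ} (h : p ∈ vandermondeSupport a b m) :
    0 < vandermondeTerm a b p := by
  rw [mem_vandermondeSupport] at h
  exact Nat.mul_pos (Nat.choose_pos h.2.1) (Nat.choose_pos h.2.2)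

theorem sum_vandermondeSupport (a b m : ℕ) :
    ∑ p ∈ vandermondeSupport a b m, vandermondeTerm a b p = (a + b).choose m := by
  rw [Nat.add_choose_eq]
  exact Finset.sum_subset (Finset.filter_subset _ _) fun p hp h => vandermondeTerm_eq_zero hp h

theorem sum_vandermondeSupport_sq (a b m : ℕ) :
    ∑ p ∈ vandermondeSupport a b m, vandermondeTerm a b p ^ 2 =
      ∑ p ∈ antidiagonal m, vandermondeTerm a b p ^ 2 :=
  Finset.sum_subset (Finset.filter_subset _ _) fun p hp h => by
    simp [vandermondeTerm_eq_zero hp h]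

/-- Complementation of a choice. -/
def vandermondeReflect (a b : ℕ) (p : ℕ × ℕ) : ℕ × ℕ := (a - p.1, b - p.2)

theorem vandermondeReflect_mem {a b m : ℕ} (hab : a + b = 2 * m) {p : ℕ × ℕ}
    (hp : p ∈ vandermondeSupport a b m) :
    vandermondeReflect a b p ∈ vandermondeSupport a b m := by
  rw [mem_vandermondeSupport] at hp ⊢
  simp only [vandermondeReflect]
  omega

theorem vandermondeTerm_reflect {a b m : ℕ} {p : ℕ × ℕ}
    (hp : p ∈ vandermondeSupport a b m) :
    vandermondeTerm a b (vandermondeReflect a b p) = vandermondeTerm a b p := by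
  rw [mem_vandermondeSupport] at hp
  simp [vandermondeTerm, vandermondeReflect, Nat.choose_symm hp.2.1, Nat.choose_symm hp.2.2]

theorem two_mul_sum_vandermondeTerm_sq_lt_of_odd {i j : ℕ} (hi : 0 < i) (hj : 0 < j) :
    2 * ∑ p ∈ antidiagonal (i + j + 1), vandermondeTerm (2 * i + 1) (2 * j + 1) p ^ 2 <
      (2 * (i + j + 1)).choose (i + j + 1) ^ 2 := by
  set a := 2 * i + 1 with ha
  set b := 2 * j + 1 with hb
  set m := i + j + 1 with hm
  have hab : a + b = 2 * m := by omega
  rw [← sum_vandermondeSupport_sq, ← hab, ← sum_vandermondeSupport]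
  have key : ∀ p ∈ vandermondeSupport a b m,
      2 * vandermondeTerm a b p ≤ ∑ q ∈ vandermondeSupport a b m, vandermondeTerm a b q :=
    fun p hp => two_mul_le_sum_of_involution _ _ (vandermondeReflect a b)
      (fun p hp => vandermondeReflect_mem hab hp) (fun p hp => vandermondeTerm_reflect hp)
      (fun p hp h => by
        have := congrArg Prod.fst h
        simp only [vandermondeReflect] at this
        omega) hp
  have h1 : (i, j + 1) ∈ vandermondeSupport a b m := by
    rw [mem_vandermondeSupport]; dsimp only; omega
  have h2 : (i + 1, j) ∈ vandermondeSupport a b m := by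
    rw [mem_vandermondeSupport]; dsimp only; omega
  have h3 : (i - 1, j + 2) ∈ vandermondeSupport a b m := by
    rw [mem_vandermondeSupport]; dsimp only; omega
  refine two_mul_sum_sq_lt_sq_sum _ _ key h1 (vandermondeTerm_pos h1) ?_
  have hsum : ∑ q ∈ {(i - 1, j + 2), (i, j + 1), (i + 1, j)}, vandermondeTerm a b q ≤
      ∑ q ∈ vandermondeSupport a b m, vandermondeTerm a b q :=
    Finset.sum_le_sum_of_subset (by
      intro q hq
      simp only [Finset.mem_insert, Finset.mem_singleton] at hq
      rcases hq with rfl | rfl | rfl <;> assumption)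
  rw [Finset.sum_insert (by simp), Finset.sum_pair (by simp)] at hsum
  have h4 := vandermondeTerm_reflect h1
  have h5 : vandermondeReflect a b (i, j + 1) = (i + 1, j) := by
    simp only [vandermondeReflect, Prod.mk.injEq]; omega
  rw [h5] at h4
  have := vandermondeTerm_pos h3
  omega

theorem two_mul_sum_vandermondeTerm_sq_lt_of_even {i j : ℕ} (hi : 0 < i) (hj : 0 < j)
    (hij : i ≠ j) :
    2 * ∑ p ∈ antidiagonal (i + j), vandermondeTerm (2 * i) (2 * j) p ^ 2 <
      (2 * (i + j)).choose (i + j) ^ 2 := by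
  set a := 2 * i with ha
  set b := 2 * j with hb
  set m := i + j with hm
  have hab : a + b = 2 * m := by omega
  rw [← sum_vandermondeSupport_sq, ← hab, ← sum_vandermondeSupport]
  have h1 : (i, j) ∈ vandermondeSupport a b m := by
    rw [mem_vandermondeSupport]; dsimp only; omega
  have h2 : (i + 1, j - 1) ∈ vandermondeSupport a b m := by
    rw [mem_vandermondeSupport]; dsimp only; omega
  have h3 : (i - 1, j + 1) ∈ vandermondeSupport a b m := by
    rw [mem_vandermondeSupport]; dsimp only; omega
  rw [← Finset.add_sum_erase _ _ h1, ← Finset.add_sum_erase _ _ h1]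
  set E := (vandermondeSupport a b m).erase (i, j) with hE
  have key := two_mul_sum_sq_le_sq_sum E (vandermondeTerm a b) fun p hp =>
    two_mul_le_sum_of_involution E _ (vandermondeReflect a b)
      (fun p hp => by
        rw [hE, Finset.mem_erase] at hp ⊢
        refine ⟨fun h => hp.1 ?_, vandermondeReflect_mem hab hp.2⟩
        have h' := mem_vandermondeSupport.1 hp.2
        simp only [vandermondeReflect, Prod.ext_iff] at h ⊢
        omega)
      (fun p hp => vandermondeTerm_reflect (Finset.mem_of_mem_erase hp))
      (fun p hp h => by
        rw [hE, Finset.mem_erase] at hp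
        refine hp.1 ?_
        have h' := mem_vandermondeSupport.1 hp.2
        simp only [vandermondeReflect, Prod.ext_iff] at h ⊢
        omega) hp
  have hsum : ∑ q ∈ {(i - 1, j + 1), (i + 1, j - 1)}, vandermondeTerm a b q ≤
      ∑ q ∈ E, vandermondeTerm a b q :=
    Finset.sum_le_sum_of_subset (by
      intro q hq
      simp only [Finset.mem_insert, Finset.mem_singleton] at hq
      rw [hE, Finset.mem_erase]
      rcases hq with rfl | rfl
      · exact ⟨by simp, h3⟩
      · exact ⟨by simp, h2⟩)
  rw [Finset.sum_pair (by simp)] at hsum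
  have h4 := vandermondeTerm_reflect h3
  have h5 : vandermondeReflect a b (i - 1, j + 1) = (i + 1, j - 1) := by
    simp only [vandermondeReflect, Prod.mk.injEq]; omega
  rw [h5] at h4
  have hq := vandermondeTerm_pos h1
  have hratio : (i + 1) * (j + 1) * vandermondeTerm a b (i - 1, j + 1) =
      i * j * vandermondeTerm a b (i, j) := by
    obtain ⟨k, rfl⟩ : ∃ k, i = k + 1 := ⟨i - 1, by omega⟩
    have e1 := Nat.choose_succ_right_eq a k
    have e2 := Nat.choose_succ_right_eq b j
    rw [show a - k = k + 1 + 1 by omega] at e1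
    rw [show b - j = j by omega] at e2
    simp only [vandermondeTerm, Nat.add_sub_cancel]
    calc (k + 1 + 1) * (j + 1) * (a.choose k * b.choose (j + 1))
        = a.choose k * (k + 1 + 1) * (b.choose (j + 1) * (j + 1)) := by ring
      _ = (k + 1) * j * (a.choose (k + 1) * b.choose j) := by rw [← e1, e2]; ring
  have hlt : (i + 1) * (j + 1) < 4 * (i * j) := by
    rcases Nat.lt_or_gt_of_ne hij with h | h <;> nlinarith
  have hu : vandermondeTerm a b (i, j) < 4 * vandermondeTerm a b (i - 1, j + 1) := by
    by_contra! hcon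
    have := Nat.mul_le_mul_left ((i + 1) * (j + 1)) hcon
    nlinarith
  nlinarith

theorem two_mul_sum_vandermondeTerm_sq_one {b m : ℕ} (hb : b + 1 = 2 * m) :
    2 * ∑ p ∈ antidiagonal m, vandermondeTerm 1 b p ^ 2 = (2 * m).choose m ^ 2 := by
  obtain ⟨k, rfl⟩ : ∃ k, m = k + 1 := ⟨m - 1, by omega⟩
  obtain rfl : b = 2 * k + 1 := by omega
  rw [Finset.sum_eq_add_of_mem (0, k + 1) (1, k) (by simp) (by simp [add_comm]) (by simp)]
  · have h1 : (2 * k + 1).choose k = (2 * k + 1).choose (k + 1) :=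
      Nat.choose_symm_of_eq_add (by omega)
    rw [show 2 * (k + 1) = 2 * k + 1 + 1 by ring, Nat.choose_succ_succ' (2 * k + 1) k, h1]
    simp [vandermondeTerm, h1]
    ring
  · rintro ⟨x, y⟩ hp h
    simp only [Finset.HasAntidiagonal.mem_antidiagonal, ne_eq, Prod.mk.injEq] at hp h
    have : 1 < x := by omega
    simp [vandermondeTerm, Nat.choose_eq_zero_of_lt this]

theorem sum_vandermondeTerm_sq_comm (a b m : ℕ) :
    ∑ p ∈ antidiagonal m, vandermondeTerm a b p ^ 2 =
      ∑ p ∈ antidiagonal m, vandermondeTerm b a p ^ 2 := by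
  rw [← Finset.Nat.sum_antidiagonal_swap]
  simp [vandermondeTerm, mul_comm]

/-- If a partition of `2 * m` objects into two nonempty parts of different sizes has a sum of squares
of Vandermonde terms as large as for a part of size `1`, then one of its parts has size `1`. -/
theorem eq_one_or_eq_one_of_le_two_mul_sum_vandermondeTerm_sq {a b m : ℕ} (hab : a + b = 2 * m)
    (ha : 0 < a) (hb : 0 < b) (hne : a ≠ b)
    (h : (2 * m).choose m ^ 2 ≤ 2 * ∑ p ∈ antidiagonal m, vandermondeTerm a b p ^ 2) :
    a = 1 ∨ b = 1 := by
  by_contra! hcon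
  refine absurd h (not_le.2 ?_)
  rcases Nat.even_or_odd' a with ⟨i, rfl | rfl⟩
  · obtain ⟨j, rfl⟩ : ∃ j, b = 2 * j := ⟨m - i, by omega⟩
    obtain rfl : m = i + j := by omega
    exact two_mul_sum_vandermondeTerm_sq_lt_of_even (by omega) (by omega) (by omega)
  · obtain ⟨j, rfl⟩ : ∃ j, b = 2 * j + 1 := ⟨m - i - 1, by omega⟩
    obtain rfl : m = i + j + 1 := by omega
    exact two_mul_sum_vandermondeTerm_sq_lt_of_odd (by omega) (by omega)

theorem two_mul_sum_choose_eq {a b d m : ℕ} (hab : a + b = 2 * m) (hd : d + 1 = a) :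
    2 * ∑ p ∈ antidiagonal m, vandermondeTerm a b p * vandermondeTerm d b p =
      ∑ p ∈ antidiagonal m, vandermondeTerm a b p ^ 2 := by
  have e : ∑ p ∈ antidiagonal m, vandermondeTerm a b p * vandermondeTerm d b p =
      ∑ p ∈ vandermondeSupport a b m, vandermondeTerm a b p * vandermondeTerm d b p :=
    (Finset.sum_subset (Finset.filter_subset _ _) fun p hp h => by
      simp [vandermondeTerm_eq_zero hp h]).symm
  have e' : ∑ p ∈ vandermondeSupport a b m, vandermondeTerm a b p * vandermondeTerm d b p =
      ∑ p ∈ vandermondeSupport a b m, vandermondeTerm a b (vandermondeReflect a b p) *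
        vandermondeTerm d b (vandermondeReflect a b p) := by
    refine Finset.sum_nbij' (vandermondeReflect a b) (vandermondeReflect a b)
      (fun p hp => vandermondeReflect_mem hab hp) (fun p hp => vandermondeReflect_mem hab hp)
      ?_ ?_ ?_ <;> intro p hp
    · have h' := mem_vandermondeSupport.1 hp
      simp only [vandermondeReflect, Prod.ext_iff]; omega
    · have h' := mem_vandermondeSupport.1 hp
      simp only [vandermondeReflect, Prod.ext_iff]; omega
    · have h' := mem_vandermondeSupport.1 hp
      have : vandermondeReflect a b (vandermondeReflect a b p) = p := by
        simp only [vandermondeReflect, Prod.ext_iff]; omega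
      rw [this]
  rw [← sum_vandermondeSupport_sq, e, two_mul]
  nth_rewrite 2 [e']
  rw [← Finset.sum_add_distrib]
  refine Finset.sum_congr rfl fun p hp => ?_
  rw [vandermondeTerm_reflect hp, ← mul_add, sq]
  congr 1
  obtain ⟨x, y⟩ := p
  have h' := mem_vandermondeSupport.1 hp
  simp only at h'
  simp only [vandermondeTerm, vandermondeReflect, Nat.choose_symm h'.2.2, ← add_mul]
  congr 1
  subst hd
  rcases x with _ | x
  · simp
  · rw [Nat.choose_succ_succ', show d + 1 - (x + 1) = d - x by omega,
      Nat.choose_symm (show x ≤ d by omega), add_comm]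

/-- The number of sets meeting the four regions cut out by `I` and `J` in prescribed cardinalities. -/
theorem card_filter_card_inter {α : Type*} [Fintype α] [DecidableEq α] (I J : Finset α)
    (x y z w : ℕ) :
    (Finset.univ.filter fun K : Finset α => (K ∩ (I ∩ J)).card = x ∧ (K ∩ (I \ J)).card = y ∧
      (K ∩ (J \ I)).card = z ∧ (K ∩ (I ∪ J)ᶜ).card = w).card =
      (I ∩ J).card.choose x * (I \ J).card.choose y * ((J \ I).card.choose z *
        (I ∪ J)ᶜ.card.choose w) := by
  simp only [← Finset.card_powersetCard, ← Finset.card_product]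
  refine Finset.card_nbij' (fun K => ((K ∩ (I ∩ J), K ∩ (I \ J)), (K ∩ (J \ I), K ∩ (I ∪ J)ᶜ)))
    (fun p => p.1.1 ∪ p.1.2 ∪ p.2.1 ∪ p.2.2) ?_ ?_ ?_ ?_
  · intro K hK
    simpa [Finset.mem_powersetCard, and_assoc] using hK
  · rintro ⟨⟨A, B⟩, C, D⟩ h
    simp only [Finset.coe_product, Set.mem_prod, Finset.mem_coe, Finset.mem_powersetCard] at h
    obtain ⟨⟨⟨hA, rfl⟩, hB, rfl⟩, ⟨hC, rfl⟩, hD, rfl⟩ := h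
    simp only [Finset.coe_filter, Finset.mem_univ, true_and, Set.mem_ofPred_eq]
    refine ⟨?_, ?_, ?_, ?_⟩ <;> congr 1 <;> ext u <;> have := @hA u <;> have := @hB u <;>
      have := @hC u <;> have := @hD u <;> simp at * <;> tauto
  · intro K hK
    ext u
    simp
    tauto
  · rintro ⟨⟨A, B⟩, C, D⟩ h
    simp only [Finset.coe_product, Set.mem_prod, Finset.mem_coe, Finset.mem_powersetCard] at h
    obtain ⟨⟨⟨hA, rfl⟩, hB, rfl⟩, ⟨hC, rfl⟩, hD, rfl⟩ := h
    simp only [Prod.mk.injEq]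
    refine ⟨⟨?_, ?_⟩, ?_, ?_⟩ <;> ext u <;> have := @hA u <;> have := @hB u <;>
      have := @hC u <;> have := @hD u <;> simp at * <;> tauto

/-- The points of `P_m` that are collinear with both `I` and `J`. -/
def commonNeighbors {n : ℕ} (m : ℕ) (I J : Finset (Fin n)) : Finset (Finset (Fin n)) :=
  Finset.univ.filter fun K => K.card = 2 * m ∧ (K ∩ I).card = m ∧ (K ∩ J).card = m

theorem card_inter_add_inter {α : Type*} [DecidableEq α] (K I J : Finset α) :
    (K ∩ (I ∩ J)).card + (K ∩ (I \ J)).card = (K ∩ I).card := by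
  rw [← Finset.card_inter_add_card_sdiff (K ∩ I) J]
  congr 2 <;> ext u <;> simp <;> tauto

theorem card_inter_compl_union {n : ℕ} (K I J : Finset (Fin n)) :
    (K ∩ I).card + (K ∩ (J \ I)).card + (K ∩ (I ∪ J)ᶜ).card = K.card := by
  rw [← Finset.card_inter_add_card_sdiff K I, ← Finset.card_inter_add_card_sdiff (K \ I) J,
    ← add_assoc]
  congr 3 <;> ext u <;> simp <;> tauto

theorem card_commonNeighbors {n m a b d : ℕ} {I J : Finset (Fin n)}
    (hIJ : (I ∩ J).card = a) (hI : (I \ J).card = b) (hJ : (J \ I).card = b)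
    (hd : (I ∪ J)ᶜ.card = d) :
    (commonNeighbors m I J).card =
      ∑ p ∈ antidiagonal m, vandermondeTerm a b p * vandermondeTerm d b p := by
  rw [Finset.card_eq_sum_card_fiberwise (t := antidiagonal m)
    (f := fun K => ((K ∩ (I ∩ J)).card, (K ∩ (I \ J)).card))]
  · refine Finset.sum_congr rfl fun p hp => ?_
    obtain ⟨x, y⟩ := p
    have h := card_filter_card_inter I J x y y x
    rw [hIJ, hI, hJ, hd, mul_comm (b.choose y) (d.choose x)] at h
    rw [vandermondeTerm, vandermondeTerm, ← h]
    congr 1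
    ext K
    simp only [Finset.HasAntidiagonal.mem_antidiagonal] at hp
    have h1 := card_inter_add_inter K I J
    have h2 := card_inter_add_inter K J I
    have h3 := card_inter_compl_union K I J
    rw [Finset.inter_comm J I] at h2
    simp only [commonNeighbors, Finset.mem_filter, Finset.mem_univ, true_and, Prod.mk.injEq]
    omega
  · intro K hK
    have h1 := card_inter_add_inter K I J
    simp only [commonNeighbors, Finset.coe_filter, Finset.mem_univ, true_and,
      Set.mem_ofPred_eq] at hK
    simp only [Finset.mem_coe, Finset.HasAntidiagonal.mem_antidiagonal]
    omega

theorem two_mul_card_commonNeighbors {n m : ℕ} (hn : n + 1 = 4 * m) {I J : Finset (Fin n)}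
    (hI : I.card = 2 * m) (hJ : J.card = 2 * m) :
    2 * (commonNeighbors m I J).card =
      ∑ p ∈ antidiagonal m, vandermondeTerm (I ∩ J).card (I \ J).card p ^ 2 := by
  have h1 := Finset.card_inter_add_card_sdiff I J
  have h2 := Finset.card_inter_add_card_sdiff J I
  have h3 := card_inter_compl_union Finset.univ I J
  simp only [Finset.univ_inter, Finset.card_univ, Fintype.card_fin] at h3
  rw [Finset.inter_comm J I] at h2
  rw [← two_mul_sum_choose_eq (d := (I ∪ J)ᶜ.card) (by omega) (by omega),
    card_commonNeighbors rfl rfl (by omega) rfl]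

theorem four_mul_card_commonNeighbors_eq_iff {n m : ℕ} (hn : n + 1 = 4 * m)
    {I J : Finset (Fin n)} (hI : I.card = 2 * m) (hJ : J.card = 2 * m) (hIJ : I ≠ J)
    (hne : (I ∩ J).card ≠ m) :
    4 * (commonNeighbors m I J).card = (2 * m).choose m ^ 2 ↔
      (I ∩ J).card = 1 ∨ (I \ J).card = 1 := by
  have h1 := Finset.card_inter_add_card_sdiff I J
  have h2 := two_mul_card_commonNeighbors hn hI hJ
  have h3 := card_inter_compl_union Finset.univ I J
  have h4 := Finset.card_inter_add_card_sdiff J I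
  simp only [Finset.univ_inter, Finset.card_univ, Fintype.card_fin] at h3
  rw [Finset.inter_comm J I] at h4
  have hpos : 0 < (I \ J).card := by
    rw [Finset.card_pos, Finset.sdiff_nonempty]
    exact fun h => hIJ (Finset.eq_of_subset_of_card_le h (by omega))
  constructor
  · intro h
    exact eq_one_or_eq_one_of_le_two_mul_sum_vandermondeTerm_sq (m := m) (by omega) (by omega) hpos
      (by omega) (by omega)
  · rintro (h | h)
    · rw [h] at h2
      have := two_mul_sum_vandermondeTerm_sq_one (b := (I \ J).card) (m := m) (by omega)
      omega
    · rw [sum_vandermondeTerm_sq_comm, h] at h2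
      have := two_mul_sum_vandermondeTerm_sq_one (b := (I ∩ J).card) (m := m) (by omega)
      omega

namespace IsAutPm

variable {n m : ℕ} {f : Finset (Fin n) → Finset (Fin n)}

theorem card_apply (hf : IsAutPm n m f) {I : Finset (Fin n)} (hI : I.card = 2 * m) :
    (f I).card = 2 * m :=
  hf.1.mapsTo hI

theorem card_commonNeighbors_apply (hf : IsAutPm n m f) {I J : Finset (Fin n)}
    (hI : I.card = 2 * m) (hJ : J.card = 2 * m) :
    (commonNeighbors m (f I) (f J)).card = (commonNeighbors m I J).card := by
  symm
  refine Finset.card_bij (fun K _ => f K) ?_ ?_ ?_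
  · intro K hK
    simp only [commonNeighbors, Finset.mem_filter, Finset.mem_univ, true_and] at hK ⊢
    exact ⟨hf.card_apply hK.1, (hf.2.1 K I hK.1 hI).1 hK.2.1, (hf.2.1 K J hK.1 hJ).1 hK.2.2⟩
  · intro K hK L hL h
    simp only [commonNeighbors, Finset.mem_filter, Finset.mem_univ, true_and] at hK hL
    exact hf.1.injOn hK.1 hL.1 h
  · intro L hL
    simp only [commonNeighbors, Finset.mem_filter, Finset.mem_univ, true_and] at hL
    obtain ⟨K, hK, rfl⟩ := hf.1.surjOn hL.1
    refine ⟨K, ?_, rfl⟩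
    simp only [commonNeighbors, Finset.mem_filter, Finset.mem_univ, true_and]
    exact ⟨hK, (hf.2.1 K I hK hI).2 hL.2.1, (hf.2.1 K J hK hJ).2 hL.2.2⟩

theorem card_inter_apply (hf : IsAutPm n m f) (hn : n + 1 = 4 * m) {I J : Finset (Fin n)}
    (hI : I.card = 2 * m) (hJ : J.card = 2 * m) (hIJ : I ≠ J) (hne : (I ∩ J).card ≠ m)
    (h : (I ∩ J).card = 1 ∨ (I \ J).card = 1) :
    (f I ∩ f J).card = 1 ∨ (f I \ f J).card = 1 := by
  rw [← four_mul_card_commonNeighbors_eq_iff hn (hf.card_apply hI) (hf.card_apply hJ)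
    (fun h => hIJ (hf.1.injOn hI hJ h)) (fun h => hne ((hf.2.1 I J hI hJ).2 h)),
    hf.card_commonNeighbors_apply hI hJ,
    four_mul_card_commonNeighbors_eq_iff hn hI hJ hIJ hne]
  exact h

end IsAutPm

theorem card_symmDiff_add {α : Type*} [DecidableEq α] (I J : Finset α) :
    (I ∆ J).card + 2 * (I ∩ J).card = I.card + J.card := by
  have h1 := Finset.card_inter_add_card_sdiff I J
  have h2 := Finset.card_inter_add_card_sdiff J I
  have h3 : (I ∆ J).card = (I \ J).card + (J \ I).card :=
    Finset.card_union_of_disjoint disjoint_sdiff_sdiff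
  rw [Finset.inter_comm J I] at h2
  omega

/-- A system of pairs indexed by pairs and compatible with symmetric differences comes from a
permutation. -/
theorem exists_perm_of_symmDiff_pairs {Ω : Type*} [Fintype Ω] [DecidableEq Ω]
    (hΩ : 5 ≤ Fintype.card Ω) (p : Ω → Ω → Finset Ω) (h2 : ∀ a b, a ≠ b → (p a b).card = 2)
    (hp : ∀ a b c, a ≠ b → b ≠ c → a ≠ c → p a b ∆ p b c = p a c) :
    ∃ σ : Equiv.Perm Ω, ∀ a b, a ≠ b → p a b = {σ a, σ b} := by
  have hsub : ∀ s : Finset Ω, s.card < 5 → ∃ x, x ∉ s := fun s hs => by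
    by_contra! h
    have := Finset.card_univ (α := Ω)
    rw [← Finset.eq_univ_iff_forall.2 h] at this
    omega
  obtain ⟨o, -⟩ := hsub ∅ (by simp)
  obtain ⟨b, hb⟩ := hsub {o} (by simp)
  obtain ⟨c, hc⟩ := hsub {o, b} (Finset.card_le_two.trans_lt (by norm_num))
  simp only [Finset.mem_insert, Finset.mem_singleton, not_or] at hb hc
  have hsymm : ∀ u v, u ≠ o → v ≠ o → u ≠ v → p o u ∆ p o v = p u v := fun u v hu hv huv => by
    rw [← hp o u v hu.symm huv hv.symm, symmDiff_symmDiff_cancel_left]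
  have hone : ∀ u v, u ≠ o → v ≠ o → u ≠ v → (p o u ∩ p o v).card = 1 := fun u v hu hv huv => by
    have h := card_symmDiff_add (p o u) (p o v)
    rw [hsymm u v hu hv huv, h2 u v huv, h2 o u hu.symm, h2 o v hv.symm] at h
    omega
  obtain ⟨x, hx⟩ := Finset.card_eq_one.1 (hone b c hb hc.1 (Ne.symm hc.2))
  have hxb : x ∈ p o b := Finset.mem_of_mem_inter_left (hx ▸ Finset.mem_singleton_self x)
  have hxc : x ∈ p o c := Finset.mem_of_mem_inter_right (hx ▸ Finset.mem_singleton_self x)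
  have hpair : ∀ u, u ≠ o → x ∈ p o u → ∃ y, y ≠ x ∧ p o u = {x, y} := fun u hu hxu => by
    obtain ⟨y, z, hyz, h⟩ := Finset.card_eq_two.1 (h2 o u hu.symm)
    rw [h] at hxu ⊢
    simp only [Finset.mem_insert, Finset.mem_singleton] at hxu
    rcases hxu with rfl | rfl
    · exact ⟨z, hyz.symm, rfl⟩
    · exact ⟨y, hyz, Finset.pair_comm _ _⟩
  have hstar : ∀ d, d ≠ o → x ∈ p o d := fun d hd => by
    by_contra hxd
    obtain ⟨e, he⟩ := hsub {o, b, c, d} (Finset.card_le_four.trans_lt (by norm_num))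
    simp only [Finset.mem_insert, Finset.mem_singleton, not_or] at he
    have hdb : d ≠ b := fun h => hxd (h ▸ hxb)
    have hdc : d ≠ c := fun h => hxd (h ▸ hxc)
    obtain ⟨y, hyx, hy⟩ := hpair b hb hxb
    obtain ⟨z, hzx, hz⟩ := hpair c hc.1 hxc
    have hbd := hone b d hb hd hdb.symm
    have hcd := hone c d hc.1 hd hdc.symm
    have hbe := hone b e hb he.1 (Ne.symm he.2.1)
    have hce := hone c e hc.1 he.1 (Ne.symm he.2.2.1)
    have hde := hone d e hd he.1 (Ne.symm he.2.2.2)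
    have hyz : y ≠ z := by
      rintro rfl
      have := h2 b c (Ne.symm hc.2)
      rw [← hsymm b c hb hc.1 (Ne.symm hc.2), hy, hz, symmDiff_self] at this
      simp at this
    have hyd : y ∈ p o d := by
      by_contra h
      rw [hy, Finset.insert_inter_of_notMem hxd, Finset.singleton_inter_of_notMem h] at hbd
      simp at hbd
    have hzd : z ∈ p o d := by
      by_contra h
      rw [hz, Finset.insert_inter_of_notMem hxd, Finset.singleton_inter_of_notMem h] at hcd
      simp at hcd
    have hd' : p o d = {y, z} :=
      (Finset.eq_of_subset_of_card_le (by
        intro w hw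
        simp only [Finset.mem_insert, Finset.mem_singleton] at hw
        rcases hw with rfl | rfl <;> assumption)
        (by rw [Finset.card_pair hyz, h2 o d hd.symm])).symm
    rw [hy, ← Finset.filter_mem_eq_inter, Finset.filter_insert, Finset.filter_singleton] at hbe
    rw [hz, ← Finset.filter_mem_eq_inter, Finset.filter_insert, Finset.filter_singleton] at hce
    rw [hd', ← Finset.filter_mem_eq_inter, Finset.filter_insert, Finset.filter_singleton] at hde
    by_cases h1 : x ∈ p o e <;> by_cases h3 : y ∈ p o e <;> by_cases h4 : z ∈ p o e <;>
      simp [h1, h3, h4, Finset.card_pair hyx.symm, Finset.card_pair hzx.symm,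
        Finset.card_pair hyz] at hbe hce hde
  have hex : ∀ u, ∃ y, u ≠ o → y ≠ x ∧ p o u = {x, y} := fun u => by
    by_cases hu : u = o
    · exact ⟨x, fun h => absurd hu h⟩
    · obtain ⟨y, hy⟩ := hpair u hu (hstar u hu)
      exact ⟨y, fun _ => hy⟩
  choose s hs using hex
  let σ : Ω → Ω := fun u => if u = o then x else s u
  have hσo : σ o = x := if_pos rfl
  have hσ : ∀ u, u ≠ o → σ u = s u := fun u hu => if_neg hu
  have hfrom : ∀ u, u ≠ o → p u o = p o u := fun u hu => by
    obtain ⟨v, hv⟩ := hsub {o, u} (Finset.card_le_two.trans_lt (by norm_num))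
    simp only [Finset.mem_insert, Finset.mem_singleton, not_or] at hv
    have h := hp u o v hu (Ne.symm hv.1) (Ne.symm hv.2)
    rw [← hsymm u v hu hv.1 (Ne.symm hv.2)] at h
    exact symmDiff_left_injective _ h
  have hall : ∀ u v, u ≠ v → p u v = {σ u, σ v} := fun u v huv => by
    by_cases hu : u = o
    · subst hu
      rw [hσo, hσ v huv.symm]
      exact (hs v huv.symm).2
    by_cases hv : v = o
    · subst hv
      rw [hσo, hσ u huv, hfrom u huv, Finset.pair_comm]
      exact (hs u huv).2
    have h := h2 u v huv
    rw [← hsymm u v hu hv huv, (hs u hu).2, (hs v hv).2] at h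
    rw [← hsymm u v hu hv huv, (hs u hu).2, (hs v hv).2, hσ u hu, hσ v hv]
    have := (hs u hu).1
    have := (hs v hv).1
    have hne : s u ≠ s v := fun h' => by simp [h'] at h
    ext w
    simp only [Finset.mem_symmDiff, Finset.mem_insert, Finset.mem_singleton]
    grind
  have hinj : Function.Injective σ := fun u v h => by
    by_contra huv
    have h' := h2 u v huv
    rw [hall u v huv, h] at h'
    simp at h'
  exact ⟨Equiv.ofBijective σ (Finite.injective_iff_bijective.1 hinj), hall⟩

/-- A function of `k`-element sets that is invariant under exchanging one element is constant. -/
theorem eq_of_forall_insert_eq {Ω β : Type*} [DecidableEq Ω] (h : Finset Ω → β) (k : ℕ)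
    (hh : ∀ A a b, a ∉ A → b ∉ A → A.card + 1 = k → h (insert a A) = h (insert b A))
    {X Y : Finset Ω} (hX : X.card = k) (hY : Y.card = k) : h X = h Y := by
  induction hd : (X \ Y).card generalizing X with
  | zero =>
    rw [Finset.card_eq_zero, Finset.sdiff_eq_empty_iff_subset] at hd
    rw [Finset.eq_of_subset_of_card_le hd (by omega)]
  | succ d ih =>
    obtain ⟨a, ha⟩ := Finset.card_pos.1 (show 0 < (X \ Y).card by omega)
    have hYX : (Y \ X).card = (X \ Y).card := by
      have h1 := Finset.card_inter_add_card_sdiff X Y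
      have h2 := Finset.card_inter_add_card_sdiff Y X
      rw [Finset.inter_comm Y X] at h2
      omega
    obtain ⟨b, hb⟩ := Finset.card_pos.1 (show 0 < (Y \ X).card by omega)
    rw [Finset.mem_sdiff] at ha hb
    have hbX : b ∉ X.erase a := fun h => hb.2 (Finset.mem_of_mem_erase h)
    have hc := Finset.card_erase_add_one ha.1
    rw [← Finset.insert_erase ha.1,
      hh (X.erase a) a b (Finset.notMem_erase a X) hbX (by omega)]
    refine ih (by rw [Finset.card_insert_of_notMem hbX]; omega) ?_
    have : insert b (X.erase a) \ Y = (X \ Y).erase a := by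
      rw [Finset.insert_sdiff_of_mem _ hb.1, Finset.erase_sdiff_comm]
    rw [this, Finset.card_erase_of_mem (Finset.mem_sdiff.2 ha)]
    omega

/-- Two non-complementary halves of a set of size `2 (2m - 1)` have a common half-way half. -/
theorem exists_card_inter_add_one_eq {Ω : Type*} [DecidableEq Ω] {m : ℕ} {U A A' : Finset Ω}
    (hU : U.card + 2 = 4 * m) (hA : A ⊆ U) (hA' : A' ⊆ U) (hcA : A.card + 1 = 2 * m)
    (hcA' : A'.card + 1 = 2 * m) (h : (A ∩ A').Nonempty) :
    ∃ B ⊆ U, B.card + 1 = 2 * m ∧ (A ∩ B).card + 1 = m ∧ (A' ∩ B).card + 1 = m := by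
  have h0 := Finset.card_pos.2 h
  have h1 := Finset.card_inter_add_card_sdiff A A'
  have h2 := Finset.card_inter_add_card_sdiff A' A
  have h3 := Finset.card_sdiff_add_card_eq_card hA
  have h4 := Finset.card_inter_add_card_sdiff (U \ A) A'
  have h5 : (U \ A) ∩ A' = A' \ A := by ext w; have := @hA' w; simp; tauto
  rw [Finset.inter_comm A' A] at h2
  rw [h5] at h4
  obtain ⟨B₁, hB₁, c₁⟩ := Finset.exists_subset_card_eq
    (show m - 1 - ((A \ A').card + 1 - m) ≤ (A ∩ A').card by omega)
  obtain ⟨B₂, hB₂, c₂⟩ := Finset.exists_subset_card_eq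
    (show (A \ A').card + 1 - m ≤ (A \ A').card by omega)
  obtain ⟨B₃, hB₃, c₃⟩ := Finset.exists_subset_card_eq
    (show (A \ A').card + 1 - m ≤ (A' \ A).card by omega)
  obtain ⟨B₄, hB₄, c₄⟩ := Finset.exists_subset_card_eq
    (show m - ((A \ A').card + 1 - m) ≤ ((U \ A) \ A').card by omega)
  simp only [Finset.subset_iff, Finset.mem_inter, Finset.mem_sdiff] at hB₁ hB₂ hB₃ hB₄ hA hA'
  have e₁ : A ∩ (B₁ ∪ B₂ ∪ (B₃ ∪ B₄)) = B₁ ∪ B₂ := by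
    ext w; simp only [Finset.mem_inter, Finset.mem_union]; grind
  have e₂ : A' ∩ (B₁ ∪ B₂ ∪ (B₃ ∪ B₄)) = B₁ ∪ B₃ := by
    ext w; simp only [Finset.mem_inter, Finset.mem_union]; grind
  have d₁ : Disjoint B₁ B₂ := Finset.disjoint_left.2 fun w h h' => (hB₂ h').2 (hB₁ h).2
  have d₂ : Disjoint B₁ B₃ := Finset.disjoint_left.2 fun w h h' => (hB₃ h').2 (hB₁ h).1
  have d₃ : Disjoint B₃ B₄ := Finset.disjoint_left.2 fun w h h' => (hB₄ h').2 (hB₃ h).1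
  have d₄ : Disjoint (B₁ ∪ B₂) (B₃ ∪ B₄) := Finset.disjoint_left.2 fun w h h' => by
    simp only [Finset.mem_union] at h h'; grind
  refine ⟨B₁ ∪ B₂ ∪ (B₃ ∪ B₄), fun w hw => ?_, ?_, ?_, ?_⟩
  · simp only [Finset.mem_union] at hw; grind
  · rw [Finset.card_union_of_disjoint d₄, Finset.card_union_of_disjoint d₁,
      Finset.card_union_of_disjoint d₃]
    omega
  · rw [e₁, Finset.card_union_of_disjoint d₁]; omega
  · rw [e₂, Finset.card_union_of_disjoint d₂]; omega

/-- Identifies a set of the extended universe with its complement: the representative that does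
not contain the extra point `none`. -/
def fold {n : ℕ} (X : Finset (Option (Fin n))) : Finset (Fin n) :=
  Finset.univ.filter fun i => ¬(some i ∈ X ↔ none ∈ X)

section fold

variable {n : ℕ}

@[simp]
theorem mem_fold {X : Finset (Option (Fin n))} {i : Fin n} :
    i ∈ fold X ↔ ¬(some i ∈ X ↔ none ∈ X) := by
  simp [fold]

theorem fold_symmDiff (X Y : Finset (Option (Fin n))) : fold (X ∆ Y) = fold X ∆ fold Y := by
  ext i
  simp only [mem_fold, Finset.mem_symmDiff]
  tauto

theorem fold_compl (X : Finset (Option (Fin n))) : fold Xᶜ = fold X := by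
  ext i
  simp only [mem_fold, Finset.mem_compl]
  tauto

theorem map_some_fold (X : Finset (Option (Fin n))) :
    (fold X).map Function.Embedding.some = if none ∈ X then Xᶜ else X := by
  ext (_ | i) <;> split_ifs with h <;> simp [h]

theorem fold_map_some (I : Finset (Fin n)) : fold (I.map Function.Embedding.some) = I := by
  ext i
  simp

theorem card_fold {m : ℕ} (hn : n + 1 = 4 * m) {X : Finset (Option (Fin n))}
    (hX : X.card = 2 * m) : (fold X).card = 2 * m := by
  rw [← Finset.card_map Function.Embedding.some, map_some_fold]
  split_ifs
  · rw [Finset.card_compl, Fintype.card_option, Fintype.card_fin]; omega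
  · exact hX

theorem card_fold_of_card_eq_two {X : Finset (Option (Fin n))} (hX : X.card = 2) :
    (fold X).card = 2 ∨ (fold X).card + 1 = n := by
  have := Finset.card_le_univ X
  rw [Fintype.card_option, Fintype.card_fin] at this
  rw [← Finset.card_map Function.Embedding.some, map_some_fold]
  split_ifs
  · rw [Finset.card_compl, Fintype.card_option, Fintype.card_fin]; omega
  · exact Or.inl hX

theorem exists_fold_eq {D : Finset (Fin n)} (hD : D.card = 2 ∨ D.card + 1 = n) :
    ∃ P : Finset (Option (Fin n)), P.card = 2 ∧ fold P = D := by
  rcases hD with hD | hD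
  · exact ⟨D.map Function.Embedding.some, by simpa using hD, fold_map_some D⟩
  · refine ⟨(D.map Function.Embedding.some)ᶜ, ?_, by rw [fold_compl, fold_map_some]⟩
    rw [Finset.card_compl, Fintype.card_option, Fintype.card_fin, Finset.card_map]
    omega

theorem eq_of_fold_eq {X Y : Finset (Option (Fin n))} (h : fold X = fold Y)
    (hc : X.card + Y.card < n + 1) : X = Y := by
  have h' := congrArg (Finset.map Function.Embedding.some) h
  have hu : Xᶜ ≠ Y := by
    rintro rfl
    rw [Finset.card_add_card_compl, Fintype.card_option, Fintype.card_fin] at hc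
    omega
  rw [map_some_fold, map_some_fold] at h'
  split_ifs at h'
  · exact compl_injective h'
  · exact absurd h' hu
  · exact absurd (by rw [h', compl_compl]) hu
  · exact h'

end fold

theorem insert_symmDiff_insert {Ω : Type*} [DecidableEq Ω] {A : Finset Ω} {a b : Ω} (ha : a ∉ A)
    (hb : b ∉ A) (hab : a ≠ b) : insert a A ∆ insert b A = {a, b} := by
  ext w
  simp only [Finset.mem_symmDiff, Finset.mem_insert, Finset.mem_singleton]
  grind

theorem insert_symmDiff_insert_same {Ω : Type*} [DecidableEq Ω] {A B : Finset Ω} {c : Ω}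
    (hA : c ∉ A) (hB : c ∉ B) : insert c A ∆ insert c B = A ∆ B := by
  ext w
  simp only [Finset.mem_symmDiff, Finset.mem_insert]
  grind

namespace IsAutPm

variable {n m : ℕ} {f : Finset (Fin n) → Finset (Fin n)}

theorem apply_fold_symmDiff (hf : IsAutPm n m f) (hn : n + 1 = 4 * m)
    {X Y : Finset (Option (Fin n))} (hX : X.card = 2 * m) (hY : Y.card = 2 * m)
    (hXY : (X ∩ Y).card = m) : f (fold (X ∆ Y)) = f (fold X) ∆ f (fold Y) := by
  rw [fold_symmDiff]
  refine hf.2.2 _ _ (card_fold hn hX) (card_fold hn hY) ?_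
  have h1 := card_symmDiff_add X Y
  have h2 := card_symmDiff_add (fold X) (fold Y)
  rw [← fold_symmDiff, card_fold hn (by omega), card_fold hn hX, card_fold hn hY] at h2
  omega

theorem exists_fold_eq_symmDiff (hf : IsAutPm n m f) (hn : n + 1 = 4 * m) (hm : 2 ≤ m)
    {A : Finset (Option (Fin n))} {a b : Option (Fin n)} (hA : A.card + 1 = 2 * m)
    (ha : a ∉ A) (hb : b ∉ A) (hab : a ≠ b) :
    ∃ P : Finset (Option (Fin n)), P.card = 2 ∧
      fold P = f (fold (insert a A)) ∆ f (fold (insert b A)) := by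
  have hIc := card_fold hn (X := insert a A) (by rw [Finset.card_insert_of_notMem ha, hA])
  have hJc := card_fold hn (X := insert b A) (by rw [Finset.card_insert_of_notMem hb, hA])
  have hD := card_fold_of_card_eq_two (Finset.card_pair hab)
  rw [← insert_symmDiff_insert ha hb hab, fold_symmDiff] at hD
  generalize fold (insert a A) = I at *
  generalize fold (insert b A) = J at *
  have h1 := card_symmDiff_add I J
  have h2 := Finset.card_inter_add_card_sdiff I J
  have hIJ : I ≠ J := by
    rintro rfl
    rw [symmDiff_self] at hD
    simp at hD
    omega
  have h3 := hf.card_inter_apply hn hIc hJc hIJ (by omega) (by omega)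
  have h4 := card_symmDiff_add (f I) (f J)
  have h5 := Finset.card_inter_add_card_sdiff (f I) (f J)
  have h6 := hf.card_apply hIc
  have h7 := hf.card_apply hJc
  exact exists_fold_eq (by omega)

theorem symmDiff_insert_eq_of_card_inter (hf : IsAutPm n m f) (hn : n + 1 = 4 * m)
    {A B : Finset (Option (Fin n))} {a b : Option (Fin n)} (hA : A.card + 1 = 2 * m)
    (hB : B.card + 1 = 2 * m) (hAB : (A ∩ B).card + 1 = m) (haA : a ∉ A) (hbA : b ∉ A)
    (haB : a ∉ B) (hbB : b ∉ B) :
    f (fold (insert a A)) ∆ f (fold (insert b A)) =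
      f (fold (insert a B)) ∆ f (fold (insert b B)) := by
  have key : ∀ c, c ∉ A → c ∉ B →
      f (fold (A ∆ B)) = f (fold (insert c A)) ∆ f (fold (insert c B)) := fun c hcA hcB => by
    rw [← hf.apply_fold_symmDiff hn (by rw [Finset.card_insert_of_notMem hcA, hA])
      (by rw [Finset.card_insert_of_notMem hcB, hB])
      (by rw [← Finset.insert_inter_distrib, Finset.card_insert_of_notMem (by simp [hcA]), hAB]),
      insert_symmDiff_insert_same hcA hcB]
  have h := (key a haA haB).symm.trans (key b hbA hbB)
  rw [← symmDiff_eq_bot] at h ⊢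
  rwa [symmDiff_symmDiff_symmDiff_comm] at h

theorem symmDiff_insert_eq (hf : IsAutPm n m f) (hn : n + 1 = 4 * m)
    {A A' : Finset (Option (Fin n))} {a b : Option (Fin n)} (hab : a ≠ b)
    (hA : A.card + 1 = 2 * m) (hA' : A'.card + 1 = 2 * m) (haA : a ∉ A) (hbA : b ∉ A)
    (haA' : a ∉ A') (hbA' : b ∉ A') :
    f (fold (insert a A)) ∆ f (fold (insert b A)) =
      f (fold (insert a A')) ∆ f (fold (insert b A')) := by
  have hU : (({a, b} : Finset (Option (Fin n)))ᶜ).card + 2 = 4 * m := by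
    rw [Finset.card_compl, Finset.card_pair hab, Fintype.card_option, Fintype.card_fin]
    omega
  have hsub : ∀ {C : Finset (Option (Fin n))}, a ∉ C → b ∉ C → C ⊆ {a, b}ᶜ := by
    intro C ha hb w hw
    simp only [Finset.mem_compl, Finset.mem_insert, Finset.mem_singleton]
    grind
  rcases Finset.eq_empty_or_nonempty (A ∩ A') with h | h
  · have hd := Finset.disjoint_iff_inter_eq_empty.2 h
    have hun : A ∪ A' = {a, b}ᶜ :=
      Finset.eq_of_subset_of_card_le (Finset.union_subset (hsub haA hbA) (hsub haA' hbA'))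
        (by rw [Finset.card_union_of_disjoint hd]; omega)
    have hmem : ∀ w, w ∈ A' ↔ w ∉ A ∧ w ≠ a ∧ w ≠ b := fun w => by
      have h1 := Finset.ext_iff.1 hun w
      have h2 : w ∈ A → w ∉ A' := fun h => Finset.disjoint_left.1 hd h
      simp only [Finset.mem_union, Finset.mem_compl, Finset.mem_insert,
        Finset.mem_singleton] at h1
      tauto
    have e1 : insert a A' = (insert b A)ᶜ := by
      ext w; simp only [Finset.mem_insert, Finset.mem_compl, hmem]; grind
    have e2 : insert b A' = (insert a A)ᶜ := by
      ext w; simp only [Finset.mem_insert, Finset.mem_compl, hmem]; grind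
    rw [e1, e2, fold_compl, fold_compl, symmDiff_comm]
  · obtain ⟨B, hBU, hB, hAB, hAB'⟩ := exists_card_inter_add_one_eq hU (hsub haA hbA)
      (hsub haA' hbA') hA hA' h
    have haB : a ∉ B := fun h => by simpa using hBU h
    have hbB : b ∉ B := fun h => by simpa using hBU h
    rw [hf.symmDiff_insert_eq_of_card_inter hn hA hB hAB haA hbA haB hbB,
      hf.symmDiff_insert_eq_of_card_inter hn hA' hB hAB' haA' hbA' haB hbB]

theorem exists_notMem_card_add_one (hn : n + 1 = 4 * m)
    (s : Finset (Option (Fin n))) (hs : s.card ≤ 3) :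
    ∃ A : Finset (Option (Fin n)), A.card + 1 = 2 * m ∧ ∀ a ∈ s, a ∉ A := by
  have hc := Finset.card_add_card_compl s
  rw [Fintype.card_option, Fintype.card_fin] at hc
  obtain ⟨A, hA, hcA⟩ := Finset.exists_subset_card_eq
    (show 2 * m - 1 ≤ sᶜ.card by omega)
  exact ⟨A, by omega, fun a ha h => Finset.mem_compl.1 (hA h) ha⟩

theorem exists_perm_symmDiff_eq (hf : IsAutPm n m f) (hn : n + 1 = 4 * m) (hm : 2 ≤ m) :
    ∃ σ : Equiv.Perm (Option (Fin n)), ∀ A a b, a ≠ b → A.card + 1 = 2 * m → a ∉ A → b ∉ A →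
      f (fold (insert a A)) ∆ f (fold (insert b A)) = fold {σ a, σ b} := by
  have hex : ∀ a b : Option (Fin n), ∃ P : Finset (Option (Fin n)), a ≠ b → P.card = 2 ∧
      ∀ A, A.card + 1 = 2 * m → a ∉ A → b ∉ A →
        fold P = f (fold (insert a A)) ∆ f (fold (insert b A)) := fun a b => by
    by_cases hab : a = b
    · exact ⟨∅, fun h => absurd hab h⟩
    · obtain ⟨A, hA, h⟩ := exists_notMem_card_add_one hn {a, b}
        (Finset.card_le_two.trans (by norm_num))
      have ha : a ∉ A := h a (by simp)
      have hb : b ∉ A := h b (by simp)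
      obtain ⟨P, hP, hPA⟩ := hf.exists_fold_eq_symmDiff hn hm hA ha hb hab
      exact ⟨P, fun _ => ⟨hP, fun A' hA' ha' hb' => by
        rw [hPA, hf.symmDiff_insert_eq hn hab hA hA' ha hb ha' hb']⟩⟩
  choose p hp using hex
  obtain ⟨σ, hσ⟩ := exists_perm_of_symmDiff_pairs
    (by rw [Fintype.card_option, Fintype.card_fin]; omega) p (fun a b hab => (hp a b hab).1)
    (fun a b c hab hbc hac => by
      obtain ⟨A, hA, h⟩ := exists_notMem_card_add_one hn {a, b, c}
        Finset.card_le_three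
      have ha : a ∉ A := h a (by simp)
      have hb : b ∉ A := h b (by simp)
      have hc : c ∉ A := h c (by simp)
      have h1 := card_symmDiff_add (p a b) (p b c)
      refine eq_of_fold_eq ?_ ?_
      · rw [fold_symmDiff, (hp a b hab).2 A hA ha hb, (hp b c hbc).2 A hA hb hc,
          (hp a c hac).2 A hA ha hc, symmDiff_symmDiff_symmDiff_comm, symmDiff_assoc]
        ext w
        simp only [Finset.mem_symmDiff]
        tauto
      · rw [(hp a b hab).1, (hp b c hbc).1] at h1
        rw [(hp a c hac).1]
        omega)
  exact ⟨σ, fun A a b hab hA ha hb => by rw [← hσ a b hab, (hp a b hab).2 A hA ha hb]⟩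

theorem exists_perm_apply_fold (hf : IsAutPm n m f) (hn : n + 1 = 4 * m) (hm : 2 ≤ m) :
    ∃ σ : Equiv.Perm (Option (Fin n)), ∀ X : Finset (Option (Fin n)), X.card = 2 * m →
      f (fold X) = fold (X.image σ) := by
  obtain ⟨σ, hσ⟩ := hf.exists_perm_symmDiff_eq hn hm
  refine ⟨σ, fun X hX => ?_⟩
  have hconst : ∀ {Y Z : Finset (Option (Fin n))}, Y.card = 2 * m → Z.card = 2 * m →
      f (fold Y) ∆ fold (Y.image σ) = f (fold Z) ∆ fold (Z.image σ) :=
    eq_of_forall_insert_eq (fun Y => f (fold Y) ∆ fold (Y.image σ)) (2 * m)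
      fun A a b ha hb hA => by
        by_cases hab : a = b
        · rw [hab]
        have h := hσ A a b hab hA ha hb
        have ha' : σ a ∉ A.image σ := by simpa using ha
        have hb' : σ b ∉ A.image σ := by simpa using hb
        rw [← insert_symmDiff_insert ha' hb' (σ.injective.ne hab), fold_symmDiff,
          ← Finset.image_insert, ← Finset.image_insert] at h
        rw [← symmDiff_eq_bot] at h ⊢
        rw [← h]
        exact symmDiff_symmDiff_symmDiff_comm _ _ _ _
  have hXc := Finset.card_add_card_compl X
  rw [Fintype.card_option, Fintype.card_fin] at hXc
  obtain ⟨S, hS, hSc⟩ := Finset.exists_subset_card_eq (show m ≤ X.card by omega)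
  obtain ⟨T, hT, hTc⟩ := Finset.exists_subset_card_eq (show m ≤ Xᶜ.card by omega)
  have hST : Disjoint S T := (disjoint_compl_right (a := X)).mono hS hT
  have hXY : X ∩ (S ∪ T) = S := by
    ext w
    have := @hS w
    have := @hT w
    simp only [Finset.mem_inter, Finset.mem_union, Finset.mem_compl] at *
    tauto
  have hY : (S ∪ T).card = 2 * m := by rw [Finset.card_union_of_disjoint hST]; omega
  have hD : (X ∆ (S ∪ T)).card = 2 * m := by
    have := card_symmDiff_add X (S ∪ T)
    rw [hXY] at this
    omega
  have h1 := hconst hX hD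
  rw [hf.apply_fold_symmDiff hn hX hY (by rw [hXY, hSc]), Finset.image_symmDiff _ _ σ.injective,
    fold_symmDiff, symmDiff_symmDiff_symmDiff_comm, ← hconst hX hY, symmDiff_self] at h1
  exact symmDiff_eq_bot.1 h1

theorem exists_perm_of_eq_three {f : Finset (Fin 3) → Finset (Fin 3)} (hf : IsAutPm 3 1 f) :
    ∃ σ : Equiv.Perm (Fin 3), ∀ I : Finset (Fin 3), I.card = 2 * 1 → f I = I.image σ := by
  have hc : ∀ i : Fin 3, ({i}ᶜ : Finset (Fin 3)).card = 2 * 1 := fun i => by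
    rw [Finset.card_compl]; simp
  have hex : ∀ I : Finset (Fin 3), I.card = 2 * 1 → ∃ i, I = {i}ᶜ := fun I hI => by
    obtain ⟨i, hi⟩ := Finset.card_eq_one.1 (show Iᶜ.card = 1 by
      rw [Finset.card_compl, hI, Fintype.card_fin])
    exact ⟨i, by rw [← hi, compl_compl]⟩
  choose s hs using fun i => hex _ (hf.card_apply (hc i))
  have hinj : Function.Injective s := fun i j hij => by
    have h := hf.1.injOn (hc i) (hc j) (by rw [hs, hs, hij])
    simpa using h
  refine ⟨Equiv.ofBijective s (Finite.injective_iff_bijective.1 hinj), fun I hI => ?_⟩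
  obtain ⟨i, rfl⟩ := hex I hI
  rw [hs]
  ext j
  obtain ⟨k, rfl⟩ := (Finite.injective_iff_bijective.1 hinj).2 j
  simp [hinj.eq_iff]

end IsAutPm

theorem fold_insert_none {n : ℕ} (I : Finset (Fin n)) :
    fold (insert none (I.map Function.Embedding.some)) = Iᶜ := by
  ext i
  simp

theorem image_map_some {n : ℕ} (σ : Equiv.Perm (Option (Fin n))) (I : Finset (Fin n))
    (h : ∀ k ∈ I, σ (some k) ≠ none) :
    (I.map Function.Embedding.some).image σ =
      (I.image (Equiv.removeNone σ)).map Function.Embedding.some := by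
  rw [Finset.map_eq_image, Finset.map_eq_image, Finset.image_image, Finset.image_image]
  exact Finset.image_congr fun k hk =>
    (Equiv.removeNone_some σ (Option.ne_none_iff_exists'.1 (h k hk))).symm

theorem fold_image_map_some {n : ℕ} (σ : Equiv.Perm (Option (Fin n))) {i : Fin n}
    (h : σ (some i) = none) (I : Finset (Fin n)) :
    fold ((I.map Function.Embedding.some).image σ) = (lmap i I).image (Equiv.removeNone σ) := by
  have hne : ∀ k, k ≠ i → σ (some k) ≠ none := fun k hk hk' =>
    hk (Option.some_injective _ (σ.injective (hk'.trans h.symm)))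
  rw [lmap]
  split_ifs with hi
  · rw [← Finset.insert_erase hi, Finset.map_insert, Finset.image_insert,
      image_map_some σ _ fun k hk => hne k (Finset.ne_of_mem_erase hk),
      Finset.insert_erase hi, Function.Embedding.some_apply, h, fold_insert_none]
    ext j
    obtain ⟨k, rfl⟩ := (Equiv.removeNone σ).surjective j
    simp
    tauto
  · rw [image_map_some σ I fun k hk => hne k (ne_of_mem_of_not_mem hk hi), fold_map_some]

/-- For `n = 4m - 1`, every automorphism of `P_m` is induced by a permutation `σ` of
`{1,…,n}`, or is of the form `σ ∘ l_i` for such a permutation and some `i`. -/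
theorem stmt_7 (n m : ℕ) (hm : 0 < m) (hn : 3 * m ≤ n) (h : n = 4 * m - 1)
    (f : Finset (Fin n) → Finset (Fin n)) (hf : IsAutPm n m f) :
    ∃ σ : Equiv.Perm (Fin n),
      (∀ I : Finset (Fin n), I.card = 2 * m → f I = I.image σ) ∨
      (∃ i : Fin n, ∀ I : Finset (Fin n), I.card = 2 * m →
        f I = (lmap i I).image σ) := by
  have hn1 : n + 1 = 4 * m := by omega
  rcases Nat.lt_or_ge m 2 with hm2 | hm2
  · obtain rfl : m = 1 := by omega
    obtain rfl : n = 3 := by omega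
    obtain ⟨σ, hσ⟩ := hf.exists_perm_of_eq_three
    exact ⟨σ, Or.inl hσ⟩
  obtain ⟨σ, hσ⟩ := hf.exists_perm_apply_fold hn1 hm2
  have key : ∀ I : Finset (Fin n), I.card = 2 * m →
      f I = fold ((I.map Function.Embedding.some).image σ) := fun I hI => by
    rw [← hσ _ (by rw [Finset.card_map, hI]), fold_map_some]
  refine ⟨Equiv.removeNone σ, ?_⟩
  rcases hi : σ.symm none with _ | i
  · refine Or.inl fun I hI => ?_
    rw [key I hI, image_map_some, fold_map_some]
    intro k _ hk
    simpa [hi] using (Equiv.eq_symm_apply σ).2 hk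
  · refine Or.inr ⟨i, fun I hI => ?_⟩
    rw [key I hI, fold_image_map_some σ (by rw [← hi, Equiv.apply_symm_apply])]
end

section
/- Suppose m ≥ 2. Fix N ⊆ {1,…,n} with |N| = 2i where 1 ≤ i ≤ min(2m, n − 2m). Consider the unordered pairs {I, J} of distinct 2m-element subsets of {1,…,n} with I △ J = N, and say that two such pairs {I, J} and {I', J'} are related (written ∼) if they are distinct pairs and |I ∩ I'| = m or |I ∩ J'| = m (for pairs with I △ J = I' △ J' = N one has |I ∩ I'| = m iff |J ∩ J'| = m, and |I ∩ J'| = m iff |J ∩ I'| = m, so this does not depend on the ordering within the pairs). If n ≥ 3m + 1, or if n = 3m and i = 1, then any two such pairs are connected by a finite chain of consecutively ∼-related pairs. -/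
open scoped symmDiff

/-- A valid pair through `P_N`: an ordered pair of distinct `2m`-element subsets whose
symmetric difference is `N`. -/
def ValidPair (n m : ℕ) (N : Finset (Fin n))
    (p : Finset (Fin n) × Finset (Fin n)) : Prop :=
  p.1.card = 2 * m ∧ p.2.card = 2 * m ∧ p.1 ≠ p.2 ∧ p.1 ∆ p.2 = N

/-- The relation `∼` on (unordered) pairs through `P_N`: two distinct pairs are related
if `|I ∩ I'| = m` or `|I ∩ J'| = m` (a condition independent of the ordering within
the pairs). -/
def PairRel (n m : ℕ) (N : Finset (Fin n))
    (p q : Finset (Fin n) × Finset (Fin n)) : Prop :=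
  ValidPair n m N p ∧ ValidPair n m N q ∧
  ({p.1, p.2} : Set (Finset (Fin n))) ≠ ({q.1, q.2} : Set (Finset (Fin n))) ∧
  ((p.1 ∩ q.1).card = m ∨ (p.1 ∩ q.2).card = m)

/-- A reflexive transitive relation that allows single exchanges inside `U` relates any two
subsets of `U` of the same size. -/
lemma rel_of_exchange {α : Type*} [DecidableEq α] {U : Finset α} {k : ℕ}
    {r : Finset α → Finset α → Prop} (hrefl : ∀ S, r S S)
    (htrans : ∀ {S T V}, r S T → r T V → r S V)
    (hex : ∀ S ⊆ U, S.card = k → ∀ a ∈ S, ∀ b ∈ U, b ∉ S → r S (insert b (S.erase a)))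
    {S T : Finset α} (hS : S ⊆ U) (hT : T ⊆ U) (hSk : S.card = k) (hTk : T.card = k) :
    r S T := by
  induction hd : (T \ S).card generalizing S with
  | zero =>
    have hTS : T ⊆ S := by simpa [Finset.sdiff_eq_empty_iff_subset] using hd
    rw [Finset.eq_of_subset_of_card_le hTS (by omega)]
    exact hrefl S
  | succ d ih =>
    have hST : (S \ T).card = (T \ S).card := by
      have h1 := Finset.card_sdiff_add_card_inter S T
      have h2 := Finset.card_sdiff_add_card_inter T S
      rw [Finset.inter_comm] at h2
      omega
    obtain ⟨b, hb⟩ : (T \ S).Nonempty := Finset.card_pos.1 (by omega)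
    obtain ⟨a, ha⟩ : (S \ T).Nonempty := Finset.card_pos.1 (by omega)
    rw [Finset.mem_sdiff] at ha hb
    have hcard : (insert b (S.erase a)).card = k := by
      rw [Finset.card_insert_of_notMem (by simp [hb.2]), Finset.card_erase_add_one ha.1, hSk]
    refine htrans (hex S hS hSk a ha.1 b (hT hb.1) hb.2) (ih ?_ hcard ?_)
    · exact Finset.insert_subset (hT hb.1) ((Finset.erase_subset _ _).trans hS)
    · have : T \ insert b (S.erase a) = (T \ S).erase b := by
        ext x
        simp only [Finset.mem_sdiff, Finset.mem_insert, Finset.mem_erase]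
        grind
      rw [this, Finset.card_erase_of_mem (by simp [hb]), hd]
      rfl

lemma exists_subset_card_inter {α : Type*} [DecidableEq α] {U S : Finset α} (hS : S ⊆ U)
    {k l : ℕ} (hk : k ≤ S.card) (hl : S.card + l ≤ U.card) :
    ∃ C ⊆ U, C.card = k + l ∧ (S ∩ C).card = k := by
  obtain ⟨P, hPS, hP⟩ := Finset.exists_subset_card_eq hk
  obtain ⟨Q, hQ, hQc⟩ := Finset.exists_subset_card_eq (s := U \ S) (n := l)
    (by rw [Finset.card_sdiff_of_subset hS]; omega)
  have hdisj : Disjoint P Q := Finset.disjoint_of_subset_left hPS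
    (Finset.disjoint_of_subset_right hQ Finset.disjoint_sdiff)
  refine ⟨P ∪ Q, Finset.union_subset (hPS.trans hS) (hQ.trans Finset.sdiff_subset), ?_, ?_⟩
  · rw [Finset.card_union_of_disjoint hdisj, hP, hQc]
  · have : S ∩ (P ∪ Q) = P := by
      ext x
      have h1 := @hPS x
      have h2 := @hQ x
      simp only [Finset.mem_inter, Finset.mem_union, Finset.mem_sdiff] at *
      tauto
    rw [this, hP]

/-- A set meeting `S` and the exchanged set `insert b (S.erase a)` in the same number of points. -/
lemma exists_subset_card_inter_exchange {α : Type*} [DecidableEq α] {U S : Finset α}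
    (hS : S ⊆ U) {a b : α} (ha : a ∈ S) (hbU : b ∈ U) (hb : b ∉ S) {k l : ℕ}
    (hk0 : 1 ≤ k) (hk : k ≤ S.card) (hl0 : 1 ≤ l) (hl : S.card + l ≤ U.card) :
    ∃ C ⊆ U, C.card = k + l ∧ (S ∩ C).card = k ∧ (insert b (S.erase a) ∩ C).card = k := by
  obtain ⟨P, haP, hPS, hP⟩ := Finset.exists_subsuperset_card_eq
    (Finset.singleton_subset_iff.2 ha) (n := k) (by simpa using hk0) hk
  obtain ⟨Q, hbQ, hQ, hQc⟩ := Finset.exists_subsuperset_card_eq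
    (Finset.singleton_subset_iff.2 (Finset.mem_sdiff.2 ⟨hbU, hb⟩)) (n := l) (by simpa using hl0)
    (by rw [Finset.card_sdiff_of_subset hS]; omega)
  rw [Finset.singleton_subset_iff] at haP hbQ
  have hdisj : Disjoint P Q := Finset.disjoint_of_subset_left hPS
    (Finset.disjoint_of_subset_right hQ Finset.disjoint_sdiff)
  refine ⟨P ∪ Q, Finset.union_subset (hPS.trans hS) (hQ.trans Finset.sdiff_subset), ?_, ?_, ?_⟩
  · rw [Finset.card_union_of_disjoint hdisj, hP, hQc]
  · have : S ∩ (P ∪ Q) = P := by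
      ext x
      have h1 := @hPS x
      have h2 := @hQ x
      simp only [Finset.mem_inter, Finset.mem_union, Finset.mem_sdiff] at *
      tauto
    rw [this, hP]
  · have : insert b (S.erase a) ∩ (P ∪ Q) = insert b (P.erase a) := by
      ext x
      have h1 := @hPS x
      have h2 := @hQ x
      simp only [Finset.mem_inter, Finset.mem_union, Finset.mem_sdiff, Finset.mem_insert,
        Finset.mem_erase] at *
      grind
    rw [this, Finset.card_insert_of_notMem (fun h => hb (hPS (Finset.mem_of_mem_erase h))),
      Finset.card_erase_add_one haP, hP]

lemma card_inter_exchange {α : Type*} [DecidableEq α] {S : Finset α} {a b : α} (ha : a ∈ S)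
    (hb : b ∉ S) : (S ∩ insert b (S.erase a)).card + 1 = S.card := by
  have : S ∩ insert b (S.erase a) = S.erase a := by
    ext x
    simp only [Finset.mem_inter, Finset.mem_insert, Finset.mem_erase]
    grind
  rw [this, Finset.card_erase_add_one ha]

/-- The pair through `P_N` whose members contain `X` outside `N` and split `N` into `A` and
its complement. -/
def splitPair {n : ℕ} (N A X : Finset (Fin n)) : Finset (Fin n) × Finset (Fin n) :=
  (A ∪ X, (N \ A) ∪ X)

/-- The data describing the pairs through `P_N`. -/
structure IsSplit {n : ℕ} (m i : ℕ) (N A X : Finset (Fin n)) : Prop where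
  subset_left : A ⊆ N
  card_left : A.card = i
  subset_right : X ⊆ Nᶜ
  card_right : X.card + i = 2 * m

section

variable {n m i : ℕ} {N A X A' X' : Finset (Fin n)}

lemma IsSplit.disjoint (h : IsSplit m i N A X) : Disjoint N X :=
  Finset.disjoint_of_subset_right h.subset_right disjoint_compl_right

lemma IsSplit.validPair (h : IsSplit m i N A X) (hN : N.card = 2 * i) (hi : 1 ≤ i) :
    ValidPair n m N (splitPair N A X) := by
  obtain ⟨hA, hAc, hX, hXc⟩ := h
  have hd := Finset.disjoint_of_subset_right hX (disjoint_compl_right (a := N))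
  have hsymm : (A ∪ X) ∆ ((N \ A) ∪ X) = N := by
    ext x
    have h1 := @hA x
    have h2 := @hX x
    simp only [Finset.mem_symmDiff, Finset.mem_union, Finset.mem_sdiff, Finset.mem_compl] at *
    tauto
  refine ⟨?_, ?_, ?_, hsymm⟩
  · simp only [splitPair]
    rw [Finset.card_union_of_disjoint (Finset.disjoint_of_subset_left hA hd)]
    omega
  · simp only [splitPair]
    rw [Finset.card_union_of_disjoint (Finset.disjoint_of_subset_left Finset.sdiff_subset hd),
      Finset.card_sdiff_of_subset hA]
    omega
  · intro heq
    simp only [splitPair] at heq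
    rw [heq, symmDiff_self] at hsymm
    rw [← hsymm] at hN
    simp at hN
    omega

lemma ValidPair.exists_isSplit {I J : Finset (Fin n)} (h : ValidPair n m N (I, J))
    (hN : N.card = 2 * i) : ∃ A X, IsSplit m i N A X ∧ (I, J) = splitPair N A X := by
  obtain ⟨hI, hJ, -, hIJ⟩ := h
  simp only at hI hJ hIJ
  have hIc := Finset.card_sdiff_add_card_inter I J
  have hJc := Finset.card_sdiff_add_card_inter J I
  rw [Finset.inter_comm] at hJc
  have hNc : (I \ J).card + (J \ I).card = 2 * i := by
    rw [← hN, ← hIJ, symmDiff_def, Finset.sup_eq_union,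
      Finset.card_union_of_disjoint disjoint_sdiff_sdiff]
  subst hIJ
  refine ⟨I \ J, I ∩ J, ⟨?_, by omega, ?_, by omega⟩, ?_⟩
  · intro x
    simp only [Finset.mem_symmDiff, Finset.mem_sdiff]
    tauto
  · intro x
    simp only [Finset.mem_compl, Finset.mem_symmDiff, Finset.mem_inter]
    tauto
  · simp only [splitPair, Prod.mk.injEq]
    constructor <;>
    · ext x
      simp only [Finset.mem_symmDiff, Finset.mem_union, Finset.mem_sdiff, Finset.mem_inter]
      tauto

lemma eq_of_union_eq_union (hA : A ⊆ N) (hX : X ⊆ Nᶜ) (hA' : A' ⊆ N) (hX' : X' ⊆ Nᶜ)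
    (h : A ∪ X = A' ∪ X') : A = A' ∧ X = X' := by
  have inter_eq : ∀ {B Y : Finset (Fin n)}, B ⊆ N → Y ⊆ Nᶜ → (B ∪ Y) ∩ N = B := by
    intro B Y hB hY
    rw [Finset.union_inter_distrib_right, Finset.inter_eq_left.2 hB,
      Finset.disjoint_iff_inter_eq_empty.1
        (Finset.disjoint_of_subset_left hY disjoint_compl_left), Finset.union_empty]
  have sdiff_eq : ∀ {B Y : Finset (Fin n)}, B ⊆ N → Y ⊆ Nᶜ → (B ∪ Y) \ N = Y := by
    intro B Y hB hY
    rw [Finset.union_sdiff_distrib, Finset.sdiff_eq_empty_iff_subset.2 hB, Finset.empty_union,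
      Finset.sdiff_eq_self_of_disjoint (Finset.disjoint_of_subset_left hY disjoint_compl_left)]
  constructor
  · rw [← inter_eq hA hX, h, inter_eq hA' hX']
  · rw [← sdiff_eq hA hX, h, sdiff_eq hA' hX']

lemma pairRel_splitPair (h : IsSplit m i N A X) (h' : IsSplit m i N A' X') (hN : N.card = 2 * i)
    (hi : 1 ≤ i) (hne : X ≠ X' ∨ (A ≠ A' ∧ A ∩ A' ≠ ∅))
    (hcard : (A ∩ A').card + (X ∩ X').card = m ∨ (A \ A').card + (X ∩ X').card = m) :
    PairRel n m N (splitPair N A X) (splitPair N A' X') := by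
  refine ⟨h.validPair hN hi, h'.validPair hN hi, ?_, ?_⟩
  · intro heq
    obtain ⟨hA, -, hX, -⟩ := h
    obtain ⟨hA', -, hX', -⟩ := h'
    have hmem : A ∪ X = A' ∪ X' ∨ A ∪ X = (N \ A') ∪ X' := by
      have : A ∪ X ∈ ({A ∪ X, (N \ A) ∪ X} : Set (Finset (Fin n))) := by simp
      simp only [splitPair] at heq
      rw [heq] at this
      simpa using this
    rcases hmem with e | e
    · obtain ⟨rfl, rfl⟩ := eq_of_union_eq_union hA hX hA' hX' e
      simp at hne
    · obtain ⟨rfl, rfl⟩ := eq_of_union_eq_union hA hX Finset.sdiff_subset hX' e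
      simp at hne
  · have hdis : Disjoint A (X ∩ X') := Finset.disjoint_of_subset_left h.subset_left
      (Finset.disjoint_of_subset_right Finset.inter_subset_left h.disjoint)
    have h1 := h.subset_left
    have h2 := h'.subset_left
    have h3 := h.subset_right
    have h4 := h'.subset_right
    refine hcard.imp (fun e => ?_) (fun e => ?_)
    · rw [← Finset.card_union_of_disjoint
        (Finset.disjoint_of_subset_left Finset.inter_subset_left hdis)] at e
      rw [← e]
      congr 1
      ext x
      have h1 := @h1 x
      have h2 := @h2 x
      have h3 := @h3 x
      have h4 := @h4 x
      simp only [splitPair, Finset.mem_union, Finset.mem_compl, Finset.mem_inter] at *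
      tauto
    · rw [← Finset.card_union_of_disjoint
        (Finset.disjoint_of_subset_left Finset.sdiff_subset hdis)] at e
      rw [← e]
      congr 1
      ext x
      have h1 := @h1 x
      have h2 := @h2 x
      have h3 := @h3 x
      have h4 := @h4 x
      simp only [splitPair, Finset.mem_union, Finset.mem_compl, Finset.mem_inter,
        Finset.mem_sdiff] at *
      tauto

lemma IsSplit.card_compl (hN : N.card = 2 * i) : Nᶜ.card + 2 * i = n := by
  have := Finset.card_add_card_compl N
  simp only [Fintype.card_fin] at this
  omega

/-- Any two pairs with the same part outside `N` are connected. -/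
lemma IsSplit.connected_left (h : IsSplit m i N A X) (h' : IsSplit m i N A' X)
    (hN : N.card = 2 * i) (hi : 2 ≤ i) (hm : 2 ≤ m) (hn : 3 * m + 1 ≤ n) (hi1 : i ≤ 2 * m)
    (hi2 : i + 2 * m ≤ n) :
    Relation.ReflTransGen (PairRel n m N) (splitPair N A X) (splitPair N A' X) := by
  refine rel_of_exchange (k := i)
    (r := fun S T => Relation.ReflTransGen (PairRel n m N) (splitPair N S X) (splitPair N T X))
    (fun _ => .refl) .trans ?_ h.subset_left h'.subset_left h.card_left h'.card_left
  intro S hSN hSi a ha b hbN hb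
  have hNc := IsSplit.card_compl hN
  have hXc := h.card_right
  obtain ⟨k, hk1, hki, hkm, hkn, hik⟩ :
      ∃ k, 1 ≤ k ∧ k + 1 ≤ i ∧ k ≤ m ∧ k + 3 * m ≤ n ∧ i ≤ m + k :=
    ⟨max 1 (i - m), by omega, by omega, by omega, by omega, by omega⟩
  obtain ⟨C, hCN, hC, hSC, hSC'⟩ := exists_subset_card_inter_exchange hSN ha hbN hb
    (k := k) (l := i - k) hk1 (by omega) (by omega) (by omega)
  obtain ⟨Y, hYN, hY, hXY⟩ := exists_subset_card_inter h.subset_right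
    (k := m - k) (l := m + k - i) (by omega) (by omega)
  have hsC : IsSplit m i N C Y := ⟨hCN, by omega, hYN, by omega⟩
  have hsS : IsSplit m i N S X := ⟨hSN, hSi, h.subset_right, hXc⟩
  have hsS' : IsSplit m i N (insert b (S.erase a)) X := by
    refine ⟨Finset.insert_subset hbN ((Finset.erase_subset _ _).trans hSN), ?_,
      h.subset_right, hXc⟩
    rw [Finset.card_insert_of_notMem (by simp [hb]), Finset.card_erase_add_one ha, hSi]
  have hne : ∀ {T : Finset (Fin n)}, T.card = i → (T ∩ C).card = k → T ≠ C ∧ T ∩ C ≠ ∅ := by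
    refine fun {T} hT hTC => ⟨?_, ?_⟩
    · rintro rfl
      rw [Finset.inter_self] at hTC
      omega
    · intro e
      rw [e, Finset.card_empty] at hTC
      omega
  refine .trans (.single (pairRel_splitPair hsS hsC hN (by omega) (.inr (hne hSi hSC))
    (.inl (by omega)))) (.single (pairRel_splitPair hsC hsS' hN (by omega) (.inr ?_) (.inl ?_)))
  · rw [Finset.inter_comm, ne_comm]
    exact hne hsS'.card_left hSC'
  · rw [Finset.inter_comm C, Finset.inter_comm Y]
    omega

/-- Any two pairs splitting `N` in the same way are connected. -/
lemma IsSplit.connected_right (h : IsSplit m i N A X) (h' : IsSplit m i N A X')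
    (hN : N.card = 2 * i) (hi : 1 ≤ i) (hm : 2 ≤ m) (hn : 3 * m ≤ n) (hi1 : i ≤ 2 * m)
    (hi2 : i + 2 * m ≤ n) (hcase : 3 * m + 1 ≤ n ∨ i = 1) :
    Relation.ReflTransGen (PairRel n m N) (splitPair N A X) (splitPair N A X') := by
  refine rel_of_exchange (k := 2 * m - i)
    (r := fun S T => Relation.ReflTransGen (PairRel n m N) (splitPair N A S) (splitPair N A T))
    (fun _ => .refl) .trans ?_ h.subset_right h'.subset_right
    (by have := h.card_right; omega) (by have := h'.card_right; omega)
  intro S hSN hSi a ha b hbN hb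
  have hNc := IsSplit.card_compl hN
  have hsS : IsSplit m i N A S := ⟨h.subset_left, h.card_left, hSN, by omega⟩
  have hsS' : IsSplit m i N A (insert b (S.erase a)) := by
    refine ⟨h.subset_left, h.card_left,
      Finset.insert_subset hbN ((Finset.erase_subset _ _).trans hSN), ?_⟩
    rw [Finset.card_insert_of_notMem (by simp [hb]), Finset.card_erase_add_one ha]
    omega
  have hne : S ≠ insert b (S.erase a) := fun e => hb (e ▸ Finset.mem_insert_self _ _)
  rcases lt_or_ge i m with him | him
  · obtain ⟨Y, hYN, hY, hSY, hSY'⟩ := exists_subset_card_inter_exchange hSN ha hbN hb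
      (k := m) (l := m - i) (by omega) (by omega) (by omega) (by omega)
    have hsY : IsSplit m i N A Y := ⟨h.subset_left, h.card_left, hYN, by omega⟩
    have hneY : ∀ {T : Finset (Fin n)}, T.card = 2 * m - i → (T ∩ Y).card = m → T ≠ Y := by
      rintro T hT hTY rfl
      rw [Finset.inter_self] at hTY
      omega
    refine .trans (.single (pairRel_splitPair hsS hsY hN hi (.inl (hneY hSi hSY))
      (.inr (by simpa using hSY)))) (.single (pairRel_splitPair hsY hsS' hN hi (.inl ?_) (.inr ?_)))
    · exact (hneY (by have := hsS'.card_right; omega) hSY').symm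
    · rw [Finset.inter_comm Y]
      simpa using hSY'
  · have hcard := card_inter_exchange ha hb
    have hA := h.card_left
    obtain ⟨C, hCN, hC, hAC⟩ := exists_subset_card_inter h.subset_left
      (k := i + 1 - m) (l := m - 1) (by omega) (by omega)
    have hsC : IsSplit m i N C (insert b (S.erase a)) :=
      ⟨hCN, by omega, hsS'.subset_right, hsS'.card_right⟩
    exact .trans (.single (pairRel_splitPair hsS hsC hN hi (.inl hne) (.inl (by omega))))
      (hsC.connected_left hsS' hN (by omega) hm (by omega) hi1 hi2)

end

/-- If `n ≥ 3m + 1`, or `n = 3m` and `i = 1`, then any two pairs of distinct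
`2m`-element subsets with symmetric difference `N` (where `|N| = 2i`) are connected by a
finite chain of consecutively `∼`-related pairs. -/
theorem stmt_9 (n m : ℕ) (hm : 2 ≤ m) (hn : 3 * m ≤ n)
    (i : ℕ) (hi1 : 1 ≤ i) (hi2 : i ≤ min (2 * m) (n - 2 * m))
    (N : Finset (Fin n)) (hN : N.card = 2 * i)
    (hcase : 3 * m + 1 ≤ n ∨ (n = 3 * m ∧ i = 1))
    (I J I' J' : Finset (Fin n))
    (hp : ValidPair n m N (I, J)) (hq : ValidPair n m N (I', J')) :
    Relation.ReflTransGen (PairRel n m N) (I, J) (I', J') ∨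
    Relation.ReflTransGen (PairRel n m N) (I, J) (J', I') := by
  obtain ⟨A, X, h, e⟩ := hp.exists_isSplit hN
  obtain ⟨A', X', h', e'⟩ := hq.exists_isSplit hN
  have h'' : IsSplit m i N A X' := ⟨h.subset_left, h.card_left, h'.subset_right, h'.card_right⟩
  have hright := h.connected_right h'' hN hi1 hm hn (by omega) (by omega) (by omega)
  rw [e]
  by_cases hi : 2 ≤ i
  · left
    rw [e']
    exact hright.trans (h''.connected_left h' hN hi hm (by omega) (by omega) (by omega))
  · have hA := h.card_left
    have hA' := h'.card_left
    by_cases hAA : A = A'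
    · left
      rw [e', ← hAA]
      exact hright
    · right
      have hdisj : Disjoint A A' := by
        obtain ⟨a, rfl⟩ := Finset.card_eq_one.1 (show A.card = 1 by omega)
        obtain ⟨b, rfl⟩ := Finset.card_eq_one.1 (show A'.card = 1 by omega)
        simpa [eq_comm] using hAA
      have hcompl : A = N \ A' := by
        refine Finset.eq_of_subset_of_card_le
          (Finset.subset_sdiff.2 ⟨h.subset_left, hdisj⟩) ?_
        rw [Finset.card_sdiff_of_subset h'.subset_left]
        omega
      have hcompl' : A' = N \ A := by
        rw [hcompl, Finset.sdiff_sdiff_eq_self h'.subset_left]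
      simp only [splitPair, Prod.mk.injEq] at e'
      have : (J', I') = splitPair N A X' := by
        rw [splitPair, ← hcompl', e'.1, e'.2, ← hcompl]
      rw [this]
      exact hright
end

section
/- Suppose m ≥ 2 and 3m ≤ n. For 1 ≤ i ≤ min(2m, n − 2m) set λ_i = C(2i, i) · C(n − 2i, 2m − i) / 2 (an integer, where C denotes the binomial coefficient). Then for every integer i with 2 ≤ i ≤ min(2m, n − 2m): λ_i = λ_1 if and only if (i = 2m − 1 and (n = 4m − 1 or n = 4m)) or (i = 2m and n = 4m + 1). -/
open Nat in
/-- Strict log-convexity of the central binomial coefficients, in product form. -/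
theorem centralBinom_mul_centralBinom_lt (l j : ℕ) (hl : 1 ≤ l) (hj : 2 ≤ j) :
    centralBinom (l + 1) * centralBinom j < 2 * centralBinom (l + j) := by
  have hstep (l : ℕ) (h : centralBinom (l + 1) * centralBinom j ≤ 2 * centralBinom (l + j)) :
      centralBinom (l + 2) * centralBinom j < 2 * centralBinom (l + 1 + j) := by
    have h1 : (l + 2) * centralBinom (l + 2) = 2 * (2 * (l + 1) + 1) * centralBinom (l + 1) :=
      succ_mul_centralBinom_succ (l + 1)
    have h2 : (l + j + 1) * centralBinom (l + 1 + j)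
        = 2 * (2 * (l + j) + 1) * centralBinom (l + j) := by
      rw [add_right_comm l 1 j]
      exact succ_mul_centralBinom_succ (l + j)
    have hpos := centralBinom_pos (l + j)
    refine lt_of_mul_lt_mul_left (a := (l + 2) * (l + j + 1)) ?_ (Nat.zero_le _)
    calc (l + 2) * (l + j + 1) * (centralBinom (l + 2) * centralBinom j)
        = (l + j + 1) * (2 * (2 * (l + 1) + 1)) * (centralBinom (l + 1) * centralBinom j) := by
          linear_combination (l + j + 1) * centralBinom j * h1
      _ ≤ (l + j + 1) * (2 * (2 * (l + 1) + 1)) * (2 * centralBinom (l + j)) := by gcongr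
      _ < (l + 2) * (2 * (2 * (l + j) + 1)) * (2 * centralBinom (l + j)) := by
          refine Nat.mul_lt_mul_of_pos_right ?_ (by positivity)
          nlinarith
      _ = (l + 2) * (l + j + 1) * (2 * centralBinom (l + 1 + j)) := by
          linear_combination 2 * (l + 2) * h2.symm
  induction l, hl using Nat.le_induction with
  | base => exact hstep 0 (by simp [show centralBinom 1 = 2 from rfl])
  | succ l _ ih => exact hstep l ih.le

theorem two_mul_choose_two_mul_add_one (j : ℕ) :
    2 * (2 * j + 1).choose j = Nat.centralBinom (j + 1) := by
  rw [Nat.centralBinom_eq_two_mul_choose, show 2 * (j + 1) = 2 * j + 1 + 1 by ring,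
    Nat.choose_succ_succ, Nat.choose_symm_half]
  ring

theorem choose_two_mul_add_succ_mul (j e : ℕ) :
    (2 * j + (e + 1)).choose j * (j + e + 1) = (2 * j + e).choose j * (2 * j + e + 1) := by
  have h := Nat.choose_mul_succ_eq (2 * j + e) j
  rw [show 2 * j + e + 1 - j = j + e + 1 by omega] at h
  exact h.symm

open Nat in
theorem centralBinom_mul_choose_le (l j : ℕ) (hl : 1 ≤ l) :
    centralBinom (l + 1) * (2 * j + 1).choose j ≤ 2 * (2 * (l + j) + 1).choose (l + j) := by
  have h1 := two_mul_choose_two_mul_add_one j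
  have h2 := two_mul_choose_two_mul_add_one (l + j)
  rcases Nat.eq_zero_or_pos j with rfl | hj
  · simpa using h2.ge
  · have h := centralBinom_mul_centralBinom_lt l (j + 1) hl (by omega)
    rw [← h1, ← add_assoc, ← h2] at h
    linarith

open Nat in
theorem centralBinom_mul_choose_lt (l j e : ℕ) (hl : 1 ≤ l) (he : 2 ≤ e) :
    centralBinom (l + 1) * (2 * j + e).choose j < 2 * (2 * (l + j) + e).choose (l + j) := by
  have hstep (e : ℕ)
      (h : centralBinom (l + 1) * (2 * j + e).choose j ≤ 2 * (2 * (l + j) + e).choose (l + j)) :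
      centralBinom (l + 1) * (2 * j + (e + 1)).choose j
        < 2 * (2 * (l + j) + (e + 1)).choose (l + j) := by
    have h1 := choose_two_mul_add_succ_mul j e
    have h2 := choose_two_mul_add_succ_mul (l + j) e
    have hpos : 0 < (2 * (l + j) + e).choose (l + j) := Nat.choose_pos (by omega)
    refine lt_of_mul_lt_mul_left (a := (j + e + 1) * (l + j + e + 1)) ?_ (Nat.zero_le _)
    calc (j + e + 1) * (l + j + e + 1) * (centralBinom (l + 1) * (2 * j + (e + 1)).choose j)
        = (l + j + e + 1) * (2 * j + e + 1)
            * (centralBinom (l + 1) * (2 * j + e).choose j) := by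
          linear_combination (l + j + e + 1) * centralBinom (l + 1) * h1
      _ ≤ (l + j + e + 1) * (2 * j + e + 1) * (2 * (2 * (l + j) + e).choose (l + j)) := by gcongr
      _ < (j + e + 1) * (2 * (l + j) + e + 1) * (2 * (2 * (l + j) + e).choose (l + j)) := by
          refine Nat.mul_lt_mul_of_pos_right ?_ (by positivity)
          nlinarith
      _ = (j + e + 1) * (l + j + e + 1) * (2 * (2 * (l + j) + (e + 1)).choose (l + j)) := by
          linear_combination 2 * (j + e + 1) * h2.symm
  induction e, he using Nat.le_induction with
  | base => exact hstep 1 (centralBinom_mul_choose_le l j hl)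
  | succ e _ ih => exact hstep e ih.le

open Nat in
theorem centralBinom_mul_choose_eq_iff (l j e : ℕ) (hl : 1 ≤ l) :
    centralBinom (l + 1) * (2 * j + e).choose j = 2 * (2 * (l + j) + e).choose (l + j)
      ↔ (e = 0 ∧ j = 1) ∨ (e = 1 ∧ j = 0) := by
  rcases e with _ | _ | e
  · simp only [add_zero, ← centralBinom_eq_two_mul_choose]
    rcases j with _ | _ | j
    · have h := succ_mul_centralBinom_succ l
      have hpos := centralBinom_pos l
      simp only [centralBinom_zero, mul_one, add_zero]
      refine iff_of_false (fun h' => ?_) (by omega)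
      rw [h'] at h
      nlinarith
    · simp [show centralBinom 1 = 2 from rfl, mul_comm]
    · exact iff_of_false (centralBinom_mul_centralBinom_lt l (j + 2) hl (by omega)).ne (by omega)
  · rcases j with _ | j
    · simpa using (two_mul_choose_two_mul_add_one l).symm
    · refine iff_of_false (Nat.ne_of_lt ?_) (by omega)
      have h := centralBinom_mul_centralBinom_lt l (j + 2) hl (by omega)
      have h1 := two_mul_choose_two_mul_add_one (j + 1)
      have h2 := two_mul_choose_two_mul_add_one (l + (j + 1))
      rw [show l + (j + 2) = l + (j + 1) + 1 by ring, ← h2, ← h1] at h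
      simp only [zero_add]
      linarith
  · exact iff_of_false (centralBinom_mul_choose_lt l j (e + 2) hl (by omega)).ne (by omega)

/-- For `m ≥ 2`, `3m ≤ n` and `2 ≤ i ≤ min(2m, n - 2m)`, with
`λ_i = C(2i, i) · C(n - 2i, 2m - i) / 2`, one has `λ_i = λ_1` if and only if
(`i = 2m - 1` and `n ∈ {4m - 1, 4m}`) or (`i = 2m` and `n = 4m + 1`). -/
theorem stmt_11 (n m : ℕ) (hm : 2 ≤ m) (hn : 3 * m ≤ n)
    (i : ℕ) (hi1 : 2 ≤ i) (hi2 : i ≤ min (2 * m) (n - 2 * m)) :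
    Nat.choose (2 * i) i * Nat.choose (n - 2 * i) (2 * m - i) / 2
      = Nat.choose (2 * 1) 1 * Nat.choose (n - 2 * 1) (2 * m - 1) / 2
    ↔ ((i = 2 * m - 1 ∧ (n = 4 * m - 1 ∨ n = 4 * m)) ∨ (i = 2 * m ∧ n = 4 * m + 1)) := by
  obtain ⟨l, rfl⟩ : ∃ l, i = l + 1 := ⟨i - 1, by omega⟩
  have hl : 1 ≤ l := by omega
  obtain ⟨ha, hb⟩ := le_min_iff.mp hi2
  have hdvd : 2 ∣ Nat.choose (2 * (l + 1)) (l + 1) * Nat.choose (n - 2 * (l + 1)) (2 * m - (l + 1)) :=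
    (Nat.two_dvd_centralBinom_succ l).mul_right _
  rw [Nat.div_left_inj hdvd (by simp), ← Nat.centralBinom_eq_two_mul_choose,
    show Nat.choose (2 * 1) 1 = 2 by rfl]
  rcases le_total (2 * m) (n - 2 * m) with h | h
  · obtain ⟨j, hj⟩ := Nat.exists_eq_add_of_le ha
    obtain ⟨e, he⟩ := Nat.exists_eq_add_of_le h
    rw [show n - 2 * (l + 1) = 2 * j + e by omega, show 2 * m - (l + 1) = j by omega,
      show n - 2 * 1 = 2 * (l + j) + e by omega, show 2 * m - 1 = l + j by omega,
      centralBinom_mul_choose_eq_iff l j e hl]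
    omega
  · obtain ⟨j, hj⟩ := Nat.exists_eq_add_of_le hb
    obtain ⟨e, he⟩ := Nat.exists_eq_add_of_le h
    rw [show n - 2 * (l + 1) = 2 * j + e by omega, show 2 * m - (l + 1) = j + e by omega,
      show n - 2 * 1 = 2 * (l + j) + e by omega, show 2 * m - 1 = l + j + e by omega,
      Nat.choose_symm_of_eq_add (show 2 * j + e = j + e + j by ring),
      Nat.choose_symm_of_eq_add (show 2 * (l + j) + e = l + j + e + (l + j) by ring),
      centralBinom_mul_choose_eq_iff l j e hl]
    omega
end

section
/- Suppose m ≥ 2 and 3m ≤ n. Let I and J be distinct subsets of {1,…,n} with |I| = |J| = 2i, where 1 ≤ i ≤ m, and suppose |I △ J| ≤ 2m. Then there exists a 2m-element subset A of {1,…,n} with |A ∩ I| = i and |A ∩ J| = i (equivalently, |A △ I| = |A △ J| = 2m). -/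
open scoped symmDiff

/-- For `m ≥ 2`, `3m ≤ n`: if `I ≠ J` are subsets of `{1,…,n}` with `|I| = |J| = 2i`,
`1 ≤ i ≤ m`, and `|I ∆ J| ≤ 2m`, then there is a `2m`-element subset `A` with
`|A ∩ I| = |A ∩ J| = i`. -/
theorem stmt_13 (n m : ℕ) (hm : 2 ≤ m) (hn : 3 * m ≤ n)
    (i : ℕ) (hi1 : 1 ≤ i) (hi2 : i ≤ m)
    (I J : Finset (Fin n)) (hIJ : I ≠ J)
    (hI : I.card = 2 * i) (hJ : J.card = 2 * i) (hd : (I ∆ J).card ≤ 2 * m) :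
    ∃ A : Finset (Fin n), A.card = 2 * m ∧ (A ∩ I).card = i ∧ (A ∩ J).card = i := by
  have hIc := Finset.card_sdiff_add_card_inter I J
  have hJc := Finset.card_sdiff_add_card_inter J I
  rw [Finset.inter_comm J I] at hJc
  have hsd : (I ∆ J).card = (I \ J).card + (J \ I).card :=
    Finset.card_union_of_disjoint disjoint_sdiff_sdiff
  have hU := Finset.card_union_add_card_inter I J
  have hO := Finset.card_add_card_compl (I ∪ J)
  rw [Fintype.card_fin] at hO
  obtain ⟨a, ha⟩ : ∃ a, a = i - (I \ J).card := ⟨_, rfl⟩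
  obtain ⟨C, hC, hCc⟩ := Finset.exists_subset_card_eq (s := I ∩ J) (n := a) (by omega)
  obtain ⟨P, hP, hPc⟩ := Finset.exists_subset_card_eq (s := I \ J) (n := i - a) (by omega)
  obtain ⟨Q, hQ, hQc⟩ := Finset.exists_subset_card_eq (s := J \ I) (n := i - a) (by omega)
  obtain ⟨R, hR, hRc⟩ := Finset.exists_subset_card_eq (s := (I ∪ J)ᶜ)
    (n := 2 * m - 2 * i + a) (by omega)
  simp only [Finset.subset_iff, Finset.mem_inter, Finset.mem_sdiff, Finset.mem_compl,
    Finset.mem_union] at hC hP hQ hR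
  have hCP : Disjoint C P := Finset.disjoint_left.2 (by grind)
  have hCQ : Disjoint C Q := Finset.disjoint_left.2 (by grind)
  have hCPQ : Disjoint (C ∪ P) Q := Finset.disjoint_left.2 (by grind)
  have hCPQR : Disjoint (C ∪ P ∪ Q) R := Finset.disjoint_left.2 (by grind)
  have hAI : (C ∪ P ∪ Q ∪ R) ∩ I = C ∪ P := by ext x; grind
  have hAJ : (C ∪ P ∪ Q ∪ R) ∩ J = C ∪ Q := by ext x; grind
  refine ⟨C ∪ P ∪ Q ∪ R, ?_, ?_, ?_⟩
  · rw [Finset.card_union_of_disjoint hCPQR, Finset.card_union_of_disjoint hCPQ,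
      Finset.card_union_of_disjoint hCP]
    omega
  · rw [hAI, Finset.card_union_of_disjoint hCP]
    omega
  · rw [hAJ, Finset.card_union_of_disjoint hCQ]
    omega
end

section
/- Suppose m ≥ 2 and n = 4m + ε with ε ∈ {−1, 0, 1}. Let I and J be nonempty subsets of {1,…,n} with |I| = 2i and |J| = 2j, where 1 ≤ i ≤ min(2m, n − 2m) and 1 ≤ j ≤ min(2m, n − 2m). Then there exists a 2m-element subset A of {1,…,n} with |A ∩ I| = i and |A ∩ J| = j (equivalently, |A △ I| = |A △ J| = 2m). -/
open scoped symmDiff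

/-- Subsets of the four cells of the Venn diagram of `I` and `J` can be chosen with arbitrary
sizes not exceeding those of the cells. -/
theorem exists_finset_card_inter_of_le {α : Type*} [Fintype α] [DecidableEq α] (I J : Finset α)
    {x y z w : ℕ} (hx : x ≤ (I ∩ J).card) (hy : y ≤ (I \ J).card) (hz : z ≤ (J \ I).card)
    (hw : w ≤ (I ∪ J)ᶜ.card) :
    ∃ A : Finset α, A.card = x + y + z + w ∧ (A ∩ I).card = x + y ∧ (A ∩ J).card = x + z := by
  obtain ⟨X, hX, rfl⟩ := Finset.exists_subset_card_eq hx
  obtain ⟨Y, hY, rfl⟩ := Finset.exists_subset_card_eq hy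
  obtain ⟨Z, hZ, rfl⟩ := Finset.exists_subset_card_eq hz
  obtain ⟨W, hW, rfl⟩ := Finset.exists_subset_card_eq hw
  simp only [Finset.subset_iff, Finset.mem_inter, Finset.mem_sdiff, Finset.mem_compl,
    Finset.mem_union] at hX hY hZ hW
  have hXY : Disjoint X Y := Finset.disjoint_left.2 fun _ h₁ h₂ => (hY h₂).2 (hX h₁).2
  have hXZ : Disjoint X Z := Finset.disjoint_left.2 fun _ h₁ h₂ => (hZ h₂).2 (hX h₁).1
  have hXYZ : Disjoint (X ∪ Y) Z := by
    rw [Finset.disjoint_union_left]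
    exact ⟨hXZ, Finset.disjoint_left.2 fun _ h₁ h₂ => (hZ h₂).2 (hY h₁).1⟩
  have hXYZW : Disjoint (X ∪ Y ∪ Z) W := by
    rw [Finset.disjoint_left]
    grind
  refine ⟨X ∪ Y ∪ Z ∪ W, ?_, ?_, ?_⟩
  · rw [Finset.card_union_of_disjoint hXYZW, Finset.card_union_of_disjoint hXYZ,
      Finset.card_union_of_disjoint hXY]
  · rw [← Finset.card_union_of_disjoint hXY]
    congr 1
    grind
  · rw [← Finset.card_union_of_disjoint hXZ]
    congr 1
    grind

/-- For `m ≥ 2` and `n = 4m + ε` with `ε ∈ {-1, 0, 1}`: if `I, J` are nonempty subsets of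
`{1,…,n}` with `|I| = 2i`, `|J| = 2j` and `1 ≤ i, j ≤ min(2m, n - 2m)`, then there is a
`2m`-element subset `A` with `|A ∩ I| = i` and `|A ∩ J| = j`. -/
theorem stmt_14 (n m : ℕ) (hm : 2 ≤ m)
    (hn : n = 4 * m - 1 ∨ n = 4 * m ∨ n = 4 * m + 1)
    (i j : ℕ) (hi1 : 1 ≤ i) (hi2 : i ≤ min (2 * m) (n - 2 * m))
    (hj1 : 1 ≤ j) (hj2 : j ≤ min (2 * m) (n - 2 * m))
    (I J : Finset (Fin n)) (hIne : I.Nonempty) (hJne : J.Nonempty)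
    (hI : I.card = 2 * i) (hJ : J.card = 2 * j) :
    ∃ A : Finset (Fin n), A.card = 2 * m ∧ (A ∩ I).card = i ∧ (A ∩ J).card = j := by
  have hIJ := Finset.card_inter_add_card_sdiff I J
  have hJI := Finset.card_inter_add_card_sdiff J I
  rw [Finset.inter_comm J I] at hJI
  have hunion := Finset.card_union_add_card_inter I J
  have hcompl := Finset.card_add_card_compl (I ∪ J)
  rw [Fintype.card_fin] at hcompl
  rw [le_min_iff] at hi2 hj2
  obtain ⟨x, hxi, hxj, hxm, hx⟩ : ∃ x, (I ∩ J).card ≤ x + i ∧ (I ∩ J).card ≤ x + j ∧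
      i + j ≤ x + 2 * m ∧ (x = 0 ∨ x + i = (I ∩ J).card ∨ x + j = (I ∩ J).card ∨
        x + 2 * m = i + j) :=
    ⟨max (max ((I ∩ J).card - i) ((I ∩ J).card - j)) (i + j - 2 * m), by omega, by omega,
      by omega, by omega⟩
  have hxt : x ≤ (I ∩ J).card := by omega
  have hx_le_i : x ≤ i := by omega
  have hx_le_j : x ≤ j := by omega
  have hxn : x + 2 * m ≤ (I ∪ J)ᶜ.card + (i + j) := by
    rcases hx with h | h | h | h <;> omega
  clear hx
  obtain ⟨A, hA, hAI, hAJ⟩ := exists_finset_card_inter_of_le I J (x := x) (y := i - x)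
    (z := j - x) (w := 2 * m + x - (i + j)) hxt (by omega) (by omega) (by omega)
  exact ⟨A, by omega, by omega, by omega⟩
end

section
/- Suppose m ≥ 2 and n = 4m. Let I, J, K be pairwise distinct nonempty subsets of {1,…,n} with K = I △ J, and suppose each of |I|, |J|, |K| belongs to {2, n − 2}. Then either |I| = |J| = |K| = 2, or exactly two of the three cardinalities |I|, |J|, |K| equal n − 2 (and the remaining one equals 2). (In geometric terms: a line of the projective space P(S) contained in P_1 ∪ P_{2m−1} lies entirely in P_1 or contains precisely two points of P_{2m−1}.) -/
open scoped symmDiff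

/-- For `m ≥ 2`, `n = 4m`: if `I, J, K = I ∆ J` are pairwise distinct nonempty subsets of
`{1,…,n}` each of cardinality `2` or `n - 2`, then either all three have cardinality `2`,
or exactly two of them have cardinality `n - 2` and the remaining one has cardinality `2`. -/
theorem stmt_15 (n m : ℕ) (hm : 2 ≤ m) (hn : n = 4 * m)
    (I J K : Finset (Fin n))
    (hIne : I.Nonempty) (hJne : J.Nonempty) (hKne : K.Nonempty)
    (h1 : I ≠ J) (h2 : I ≠ K) (h3 : J ≠ K)
    (hK : K = I ∆ J)
    (hIc : I.card = 2 ∨ I.card = n - 2)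
    (hJc : J.card = 2 ∨ J.card = n - 2)
    (hKc : K.card = 2 ∨ K.card = n - 2) :
    (I.card = 2 ∧ J.card = 2 ∧ K.card = 2) ∨
    (I.card = n - 2 ∧ J.card = n - 2 ∧ K.card = 2) ∨
    (I.card = n - 2 ∧ J.card = 2 ∧ K.card = n - 2) ∨
    (I.card = 2 ∧ J.card = n - 2 ∧ K.card = n - 2) := by
  have hI : (I \ J).card + (I ∩ J).card = I.card := Finset.card_sdiff_add_card_inter I J
  have hJ : (J \ I).card + (I ∩ J).card = J.card := by
    rw [Finset.inter_comm, Finset.card_sdiff_add_card_inter]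
  have hIJ : K.card = (I \ J).card + (J \ I).card := by
    rw [hK, symmDiff_def, Finset.sup_eq_union, Finset.card_union_of_disjoint disjoint_sdiff_sdiff]
  have hU : (I ∪ J).card + (I ∩ J).card = I.card + J.card := Finset.card_union_add_card_inter I J
  have hle : (I ∪ J).card ≤ n := card_finset_fin_le _
  omega
end

section
/- Let n, t, i be natural numbers with 1 < t < n and max(0, 2t − n) ≤ i < t, and assume additionally that n > 2t if i = 0. Then the graph J(n, t, i), whose vertices are the t-element subsets of {1,…,n} and in which two such subsets are adjacent if and only if their intersection has exactly i elements, is connected. -/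
/-- Two `t`-subsets that differ by exchanging one element have a common neighbour in the
generalized Johnson graph. -/
theorem exists_common_inter_card {n t i : ℕ} (h3 : 2 * t ≤ n + i) (h4 : i < t)
    (h5 : i = 0 → 2 * t < n) (C : Finset (Fin n)) (a b : Fin n) (ha : a ∉ C) (hb : b ∉ C)
    (hab : a ≠ b) (hC : C.card + 1 = t) :
    ∃ S : Finset (Fin n), S.card = t ∧ (insert a C ∩ S).card = i ∧
      (S ∩ insert b C).card = i := by
  have hU : (insert a (insert b C))ᶜ.card = n - (t + 1) := by
    rw [Finset.card_compl, Fintype.card_fin, Finset.card_insert_of_notMem (by simp [hab, ha]),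
      Finset.card_insert_of_notMem hb, hC]
  rcases Nat.eq_zero_or_pos i with hi | hi
  · obtain ⟨E, hE, hEc⟩ := Finset.exists_subset_card_eq
      (s := (insert a (insert b C))ᶜ) (n := t) (by have := h5 hi; omega)
    have hE' : ∀ x ∈ E, x ≠ a ∧ x ≠ b ∧ x ∉ C := fun x hx => by simpa using hE hx
    refine ⟨E, hEc, ?_, ?_⟩ <;>
    · rw [hi, Finset.card_eq_zero]
      ext x
      have := hE' x
      simp only [Finset.mem_inter, Finset.mem_insert, Finset.notMem_empty]
      tauto
  · obtain ⟨D, hD, hDc⟩ := Finset.exists_subset_card_eq (s := C) (n := i - 1) (by omega)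
    obtain ⟨E, hE, hEc⟩ := Finset.exists_subset_card_eq
      (s := (insert a (insert b C))ᶜ) (n := t - i - 1) (by omega)
    have hE' : ∀ x ∈ E, x ≠ a ∧ x ≠ b ∧ x ∉ C := fun x hx => by simpa using hE hx
    have haD : a ∉ D := fun h => ha (hD h)
    have hbD : b ∉ D := fun h => hb (hD h)
    have haE : a ∉ E := fun h => (hE' a h).1 rfl
    have hbE : b ∉ E := fun h => (hE' b h).2.1 rfl
    have hDE : Disjoint D E := Finset.disjoint_left.2 fun x hx hx' => (hE' x hx').2.2 (hD hx)
    refine ⟨insert a (insert b (D ∪ E)), ?_, ?_, ?_⟩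
    · rw [Finset.card_insert_of_notMem (by simp [hab, haD, haE]),
        Finset.card_insert_of_notMem (by simp [hbD, hbE]), Finset.card_union_of_disjoint hDE]
      omega
    · have : insert a C ∩ insert a (insert b (D ∪ E)) = insert a D := by
        ext x
        have := hE' x
        have := @hD x
        simp only [Finset.mem_inter, Finset.mem_insert, Finset.mem_union]
        grind
      rw [this, Finset.card_insert_of_notMem haD]
      omega
    · have : insert a (insert b (D ∪ E)) ∩ insert b C = insert b D := by
        ext x
        have := hE' x
        have := @hD x
        simp only [Finset.mem_inter, Finset.mem_insert, Finset.mem_union]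
        grind
      rw [this, Finset.card_insert_of_notMem hbD]
      omega

/-- The generalized Johnson graph `J(n, t, i)`: vertices are the `t`-element subsets of
`{1,…,n}`, two distinct subsets being adjacent iff their intersection has exactly `i`
elements. If `1 < t < n`, `max(0, 2t - n) ≤ i < t`, and `n > 2t` whenever `i = 0`,
then this graph is connected. -/
theorem stmt_16 (n t i : ℕ) (h1 : 1 < t) (h2 : t < n)
    (h3 : max 0 (2 * t - n) ≤ i) (h4 : i < t) (h5 : i = 0 → n > 2 * t) :
    (SimpleGraph.fromRel
      (fun A B : {S : Finset (Fin n) // S.card = t} =>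
        (A.1 ∩ B.1).card = i)).Connected := by
  set G := SimpleGraph.fromRel
      (fun A B : {S : Finset (Fin n) // S.card = t} => (A.1 ∩ B.1).card = i) with hG
  have adj : ∀ A B : {S : Finset (Fin n) // S.card = t}, (A.1 ∩ B.1).card = i → G.Adj A B := by
    intro A B h
    rw [hG, SimpleGraph.fromRel_adj]
    refine ⟨?_, Or.inl h⟩
    rintro rfl
    rw [Finset.inter_self, A.2] at h
    omega
  have reach : ∀ (k : ℕ) (A B : {S : Finset (Fin n) // S.card = t}),
      (A.1 \ B.1).card = k → G.Reachable A B := by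
    intro k
    induction k with
    | zero =>
      intro A B h
      have hAB : A.1 ⊆ B.1 := Finset.sdiff_eq_empty_iff_subset.1 (Finset.card_eq_zero.1 h)
      have : A = B := Subtype.ext (Finset.eq_of_subset_of_card_le hAB (by rw [A.2, B.2]))
      rw [this]
    | succ k ih =>
      intro A B h
      have hBA : (B.1 \ A.1).card = k + 1 := by
        rw [← h]
        exact Finset.card_sdiff_comm (B.2.trans A.2.symm)
      obtain ⟨a, ha⟩ := Finset.card_pos.1 (by omega : 0 < (A.1 \ B.1).card)
      obtain ⟨b, hb⟩ := Finset.card_pos.1 (by omega : 0 < (B.1 \ A.1).card)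
      rw [Finset.mem_sdiff] at ha hb
      have hC : (A.1.erase a).card + 1 = t := (Finset.card_erase_add_one ha.1).trans A.2
      have hbC : b ∉ A.1.erase a := fun hm => hb.2 (Finset.mem_of_mem_erase hm)
      obtain ⟨S, hS, hS1, hS2⟩ := exists_common_inter_card (by omega) h4 h5 (A.1.erase a) a b
        (Finset.notMem_erase a _) hbC (by rintro rfl; exact hb.2 ha.1) hC
      rw [Finset.insert_erase ha.1] at hS1
      let A' : {S : Finset (Fin n) // S.card = t} :=
        ⟨insert b (A.1.erase a), by rw [Finset.card_insert_of_notMem hbC, hC]⟩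
      refine (adj A ⟨S, hS⟩ hS1).reachable.trans ((adj ⟨S, hS⟩ A' hS2).reachable.trans (ih A' B ?_))
      have : A'.1 \ B.1 = (A.1 \ B.1).erase a := by
        rw [Finset.insert_sdiff_of_mem _ hb.1, Finset.erase_sdiff_comm]
      rw [this, Finset.card_erase_of_mem (Finset.mem_sdiff.2 ha), h, Nat.add_sub_cancel]
  obtain ⟨S, -, hS⟩ := Finset.exists_subset_card_eq
    (s := (Finset.univ : Finset (Fin n))) (n := t) (by simpa using h2.le)
  have : Nonempty {S : Finset (Fin n) // S.card = t} := ⟨⟨S, hS⟩⟩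
  exact ⟨fun A B => reach _ A B rfl⟩
end

section
/- Let X be a nonempty subset of {1,…,n} with |X| = 2i for some integer i ≥ 1. Then there exist subsets I and J of {1,…,n} with |I| = |J| = 2m and I △ J = X if and only if i ≤ min(2m, n − 2m). (Equivalently, the set of points of the projective space over the two-element field expressible as P_I ⊙ P_J for distinct points P_I, P_J of P_m is exactly the union of the sets P_i over 1 ≤ i ≤ min(2m, n − 2m).) -/
open scoped symmDiff

/-- Two sets of size `k` whose symmetric difference has size `2i` have a union of size `k + i`
and an intersection of size `k - i`. -/
lemma Finset.card_union_and_inter_of_card_symmDiff {α : Type*} [DecidableEq α] {I J : Finset α}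
    {k i : ℕ} (hI : I.card = k) (hJ : J.card = k) (h : (I ∆ J).card = 2 * i) :
    (I ∪ J).card = k + i ∧ (I ∩ J).card + i = k := by
  have hsymm : (I ∆ J).card = (I \ J).card + (J \ I).card :=
    Finset.card_union_of_disjoint disjoint_sdiff_sdiff
  have h₁ := Finset.card_sdiff_add_card_inter I J
  have h₂ := Finset.card_sdiff_add_card_inter J I
  have h₃ := Finset.card_union_add_card_inter I J
  rw [Finset.inter_comm J I] at h₂
  omega

/-- A set `X` of size `2i` is the symmetric difference of two sets of size `k` as soon as
`i ≤ k` and `k + i` is at most the size of the ambient type. -/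
lemma Finset.exists_symmDiff_eq_of_card {α : Type*} [Fintype α] [DecidableEq α] {X : Finset α}
    {k i : ℕ} (hX : X.card = 2 * i) (hik : i ≤ k) (hk : k + i ≤ Fintype.card α) :
    ∃ I J : Finset α, I.card = k ∧ J.card = k ∧ I ∆ J = X := by
  obtain ⟨A, hAX, hA⟩ := Finset.exists_subset_card_eq (s := X) (n := i) (by omega)
  obtain ⟨C, hCX, hC⟩ := Finset.exists_subset_card_eq (s := Xᶜ) (n := k - i)
    (by rw [Finset.card_compl]; omega)
  have hdisj : Disjoint X C := Finset.disjoint_left.2 fun x hx hxC =>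
    Finset.mem_compl.1 (hCX hxC) hx
  refine ⟨A ∪ C, (X \ A) ∪ C, ?_, ?_, ?_⟩
  · rw [Finset.card_union_of_disjoint (hdisj.mono_left hAX)]
    omega
  · rw [Finset.card_union_of_disjoint (hdisj.mono_left Finset.sdiff_subset),
      Finset.card_sdiff_of_subset hAX]
    omega
  · ext x
    have h₁ : x ∈ A → x ∈ X := fun h => hAX h
    have h₂ : x ∈ X → x ∉ C := fun h => Finset.disjoint_left.1 hdisj h
    simp only [Finset.mem_symmDiff, Finset.mem_union, Finset.mem_sdiff]
    tauto

/-- A nonempty subset `X` of `{1,…,n}` with `|X| = 2i`, `i ≥ 1`, is the symmetric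
difference of two `2m`-element subsets if and only if `i ≤ min(2m, n - 2m)`. -/
theorem stmt_17 (n m : ℕ) (hm : 0 < m) (hn : 3 * m ≤ n)
    (i : ℕ) (hi : 1 ≤ i) (X : Finset (Fin n)) (hX : X.card = 2 * i) :
    (∃ I J : Finset (Fin n), I.card = 2 * m ∧ J.card = 2 * m ∧ I ∆ J = X) ↔
      i ≤ min (2 * m) (n - 2 * m) := by
  constructor
  · rintro ⟨I, J, hI, hJ, rfl⟩
    obtain ⟨hunion, hinter⟩ := Finset.card_union_and_inter_of_card_symmDiff hI hJ hX
    have hle := Finset.card_le_univ (I ∪ J)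
    rw [Fintype.card_fin] at hle
    omega
  · intro h
    exact Finset.exists_symmDiff_eq_of_card hX (by omega) (by rw [Fintype.card_fin]; omega)
end

section
/- Let V = F_2^n be the n-dimensional vector space over the two-element field, and suppose 3m ≤ n for positive integers n, m. Then the F_2-linear span of the set of vectors of Hamming weight exactly 2m equals the hyperplane S = {(x_1,…,x_n) ∈ V : x_1 + ⋯ + x_n = 0}. In particular, every nonzero vector of even Hamming weight is a sum of vectors of Hamming weight 2m. -/
theorem sum_eq_hammingNorm {ι : Type*} [Fintype ι] (x : ι → ZMod 2) :
    ∑ k, x k = (hammingNorm x : ZMod 2) := by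
  rw [hammingNorm, Finset.card_filter, Nat.cast_sum]
  refine Finset.sum_congr rfl fun k _ => ?_
  generalize x k = a
  revert a
  decide

theorem hammingNorm_indicator_one {ι : Type*} [Fintype ι] [DecidableEq ι] (s : Finset ι) :
    hammingNorm (fun k => if k ∈ s then (1 : ZMod 2) else 0) = s.card := by
  simp [hammingNorm]

/-- Differences of standard basis vectors are spanned by the vectors of any fixed positive
weight less than the dimension. -/
theorem single_sub_single_mem_span_hammingNorm {ι : Type*} [Fintype ι] [DecidableEq ι]
    {w : ℕ} (hw : w + 1 < Fintype.card ι) (i j : ι) :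
    (Pi.single i 1 - Pi.single j 1 : ι → ZMod 2) ∈
      Submodule.span (ZMod 2) {x : ι → ZMod 2 | hammingNorm x = w + 1} := by
  have hcard : w ≤ ({i, j}ᶜ : Finset ι).card := by
    have := Finset.card_le_two (a := i) (b := j)
    rw [Finset.card_compl]
    omega
  obtain ⟨T, hT, hTw⟩ := Finset.exists_subset_card_eq hcard
  have hi : i ∉ T := fun h => by simpa using hT h
  have hj : j ∉ T := fun h => by simpa using hT h
  have key : ∀ a ∉ T, (fun k => if k ∈ insert a T then (1 : ZMod 2) else 0) ∈
      Submodule.span (ZMod 2) {x : ι → ZMod 2 | hammingNorm x = w + 1} := fun a ha =>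
    Submodule.subset_span <| by
      rw [Set.mem_ofPred_eq, hammingNorm_indicator_one, Finset.card_insert_of_notMem ha, hTw]
  convert Submodule.sub_mem _ (key i hi) (key j hj) using 1
  ext k
  simp only [Pi.sub_apply, Pi.single_apply, Finset.mem_insert]
  by_cases hk : k ∈ T
  · have hki : k ≠ i := fun h => hi (h ▸ hk)
    have hkj : k ≠ j := fun h => hj (h ▸ hk)
    simp [hk, hki, hkj]
  · simp [hk]

/-- For positive integers `n, m` with `3m ≤ n`, the `F₂`-linear span of the set of
vectors of `F₂ⁿ` of Hamming weight exactly `2m` is the hyperplane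
`S = {x : x₁ + ⋯ + xₙ = 0}`. -/
theorem stmt_18 (n m : ℕ) (hm : 0 < m) (hn : 3 * m ≤ n) :
    (Submodule.span (ZMod 2)
        {x : Fin n → ZMod 2 | hammingNorm x = 2 * m} : Set (Fin n → ZMod 2))
      = {x : Fin n → ZMod 2 | ∑ k, x k = 0} := by
  ext x
  simp only [SetLike.mem_coe, Set.mem_ofPred_eq]
  constructor
  · intro hx
    induction hx using Submodule.span_induction with
    | mem y hy =>
      rw [Set.mem_ofPred_eq] at hy
      rw [sum_eq_hammingNorm, hy, ZMod.natCast_eq_zero_iff]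
      exact dvd_mul_right 2 m
    | zero => simp
    | add y z _ _ hy hz => simp [Finset.sum_add_distrib, hy, hz]
    | smul a y _ hy => simp [← Finset.mul_sum, hy]
  · intro hx
    obtain ⟨w, hw⟩ : ∃ w, 2 * m = w + 1 := ⟨2 * m - 1, by omega⟩
    let o : Fin n := ⟨0, by omega⟩
    have hsum : x = ∑ k, x k • (Pi.single k 1 - Pi.single o 1 : Fin n → ZMod 2) := by
      simp_rw [smul_sub, Finset.sum_sub_distrib, ← Finset.sum_smul, hx, zero_smul, sub_zero]
      exact pi_eq_sum_univ' x
    rw [hw, hsum]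
    exact Submodule.sum_mem _ fun k _ => Submodule.smul_mem _ _ <|
      single_sub_single_mem_span_hammingNorm (by rw [Fintype.card_fin]; omega) k o
end
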